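/- Let d, p be positive integers, let ℓ be a nonnegative integer, let Q, R > 0, and let f : ℝ^d → ℝ^p be (Q,R)-analytic. Then for every integer K ≥ 2 and every integer s ≥ max{ℓ+1, 3}, there exists a ReQU network h_f : [0,1]^d → ℝ^p with width at most max{4d(K+s−1)^d, 12(K+2s−2)+12, p}, with 6 + 2(s−3) + ⌈log₂ d⌉ + 2·max{⌈max{log₂(2d(s−1)+d), log₂ log₂(Q R^{−s} s!)}⌉, 1} hidden layers (where log₂ log₂ t is interpreted as 0 whenever t ≤ 2), all weights in [−1,1], and at most p(K+s−1)^d ( 60·max{⌈max{log₂(2d(s−1)+d), log₂ log₂(Q R^{−s} s!)}⌉, 1} + 38 + 20d² + 144d(s−1) + 8d ) nonzero weights, such that ‖f − h_f‖_{H^ℓ([0,1]^d)} ≤ Q e (√2·e·d·9^d)^ℓ (2s−1)^{2d+2ℓ} R^{−ℓ} · ( 2d·9^d (s−ℓ) / (KR) )^{s−ℓ}. -/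

import Mathlib

open scoped BigOperators Classical

noncomputable def requ (t : ℝ) : ℝ := (max t 0) ^ 2

structure ReQUNet where
  L : ℕ
  arch : ℕ → ℕ
  W : ℕ → ℕ → ℕ → ℝ
  v : ℕ → ℕ → ℝ

namespace ReQUNet

noncomputable def hidden (N : ReQUNet) (x : ℕ → ℝ) : ℕ → ℕ → ℝ
  | 0, j => ∑ k ∈ Finset.range (N.arch 0), N.W 0 j k * x k
  | i + 1, j =>
      ∑ k ∈ Finset.range (N.arch (i + 1)),
        N.W (i + 1) j k * requ (N.hidden x i k - N.v (i + 1) k)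

noncomputable def eval (N : ReQUNet) (x : ℕ → ℝ) : ℕ → ℝ := N.hidden x N.L

noncomputable def evalVec (N : ReQUNet) (d : ℕ) (x : Fin d → ℝ) : ℕ → ℝ :=
  N.eval fun k => if h : k < d then x ⟨k, h⟩ else 0

def width (N : ReQUNet) : ℕ := (Finset.range (N.L + 2)).sup N.arch

def weightsIn (N : ReQUNet) (s : Set ℝ) : Prop :=
  (∀ i ≤ N.L, ∀ j < N.arch (i + 1), ∀ k < N.arch i, N.W i j k ∈ s) ∧
  ∀ i, 1 ≤ i → i ≤ N.L → ∀ j < N.arch i, N.v i j ∈ s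

noncomputable def numNonzero (N : ReQUNet) : ℕ :=
  (∑ i ∈ Finset.range (N.L + 1),
    ((Finset.range (N.arch (i + 1)) ×ˢ Finset.range (N.arch i)).filter
      fun p => N.W i p.1 p.2 ≠ 0).card) +
  ∑ i ∈ Finset.Icc 1 N.L,
    ((Finset.range (N.arch i)).filter fun j => N.v i j ≠ 0).card

end ReQUNet

noncomputable def pderiv1 {d : ℕ} (i : Fin d) (g : (Fin d → ℝ) → ℝ) : (Fin d → ℝ) → ℝ :=
  fun x => fderiv ℝ g x (Pi.single i 1)

noncomputable def mderiv {d : ℕ} (γ : Fin d → ℕ) (g : (Fin d → ℝ) → ℝ) : (Fin d → ℝ) → ℝ :=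
  (List.finRange d).foldr (fun i h => (pderiv1 i)^[γ i] h) g

noncomputable def eucDist {d : ℕ} (x y : Fin d → ℝ) : ℝ :=
  Real.sqrt (∑ i, (x i - y i) ^ 2)

def cube (d : ℕ) : Set (Fin d → ℝ) := Set.Icc 0 1

def cubeHO (d : ℕ) : Set (Fin d → ℝ) := Set.Ico 0 1

def HolderNormLeOn {d : ℕ} (Ω : Set (Fin d → ℝ)) : ℕ → ((Fin d → ℝ) → ℝ) → ℝ → Prop
  | 0, g, E => ∀ x ∈ Ω, |g x| ≤ E
  | m + 1, g, E =>
      (∀ γ : Fin d → ℕ, (∑ i, γ i) ≤ m → ∀ x ∈ Ω, |mderiv γ g x| ≤ E) ∧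
      ∀ γ : Fin d → ℕ, (∑ i, γ i) = m → ∀ x ∈ Ω, ∀ y ∈ Ω, x ≠ y →
        |mderiv γ g x - mderiv γ g y| ≤ E * min 1 (eucDist x y)

def VHolderNormLe {d : ℕ} (p ℓ : ℕ) (f : (Fin d → ℝ) → Fin p → ℝ) (E : ℝ) : Prop :=
  ∀ i : Fin p, HolderNormLeOn (cube d) ℓ (fun x => f x i) E

noncomputable def lfloor (β : ℝ) : ℕ := ⌈β⌉₊ - 1

def MemHolderBall {d : ℕ} (p : ℕ) (β H : ℝ) (f : (Fin d → ℝ) → Fin p → ℝ) : Prop :=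
  (∀ i : Fin p, ContDiff ℝ (lfloor β : ℕ∞) fun x => f x i) ∧
  (∀ i : Fin p, ∀ γ : Fin d → ℕ, (∑ j, γ j) ≤ lfloor β →
      ∀ x ∈ cube d, |mderiv γ (fun y => f y i) x| ≤ H) ∧
  ∀ i : Fin p, ∀ γ : Fin d → ℕ, (∑ j, γ j) = lfloor β →
      ∀ x ∈ cube d, ∀ y ∈ cube d, x ≠ y →
        |mderiv γ (fun z => f z i) x - mderiv γ (fun z => f z i) y| ≤
          H * min 1 (eucDist x y) ^ (β - (lfloor β : ℝ))

def MemHolderBall1 {d : ℕ} (β H : ℝ) (f : (Fin d → ℝ) → ℝ) : Prop :=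
  (ContDiff ℝ (lfloor β : ℕ∞) f) ∧
  (∀ γ : Fin d → ℕ, (∑ j, γ j) ≤ lfloor β → ∀ x ∈ cube d, |mderiv γ f x| ≤ H) ∧
  ∀ γ : Fin d → ℕ, (∑ j, γ j) = lfloor β →
      ∀ x ∈ cube d, ∀ y ∈ cube d, x ≠ y →
        |mderiv γ f x - mderiv γ f y| ≤ H * min 1 (eucDist x y) ^ (β - (lfloor β : ℝ))

noncomputable def loglog2 (H : ℝ) : ℝ := if H ≤ 2 then 0 else Real.logb 2 (Real.logb 2 H)

noncomputable def knot (q K j : ℕ) : ℝ :=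
  if j ≤ q + 1 then 0 else if j ≤ q + K then ((j - (q + 1) : ℕ) : ℝ) / K else 1

noncomputable def Bspl (q K : ℕ) : ℕ → ℕ → ℝ → ℝ
  | 0, j, x =>
      if knot q K j < knot q K (j + 1) ∧ knot q K j ≤ x ∧ x < knot q K (j + 1) then
        1 / (knot q K (j + 1) - knot q K j)
      else 0
  | m + 1, j, x =>
      if knot q K j < knot q K (j + m + 2) ∧ knot q K j ≤ x ∧ x < knot q K (j + m + 2) then
        ((x - knot q K j) * Bspl q K m j x
            + (knot q K (j + m + 2) - x) * Bspl q K m (j + 1) x) /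
          (knot q K (j + m + 2) - knot q K j)
      else 0

noncomputable def Nspl (q K m j : ℕ) (x : ℝ) : ℝ :=
  (knot q K (j + m + 1) - knot q K j) * Bspl q K m j x

def QRanalytic {d : ℕ} (p : ℕ) (Q R : ℝ) (f : (Fin d → ℝ) → Fin p → ℝ) : Prop :=
  (∀ i : Fin p, ContDiff ℝ (⊤ : ℕ∞) fun x => f x i) ∧
  ∀ s : ℕ, VHolderNormLe p s f (Q * ((R : ℝ) ^ s)⁻¹ * (Nat.factorial s : ℝ))

def archSpec (q K i : ℕ) : ℕ :=
  if i = 0 then 1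
  else if i = 1 then 4 * (K + 2 * q - 1) + K
  else if i ≤ 4 then 4 * K + 8 * q
  else if i ≤ 4 + 2 * (q - 2) then
    (if (i - 5) % 2 = 0 then 12 * (K + 2 * q - (3 + (i - 5) / 2)) + 12
      else 8 * (K + 2 * q - (3 + (i - 5) / 2)) + 8)
  else K + q + 2

namespace ReQUNet

lemma hidden_congr {N N' : ReQUNet} {D : ℕ} (harch : ∀ i ≤ D, N.arch i = N'.arch i)
    (hW : ∀ i ≤ D, N.W i = N'.W i) (hv : ∀ i ≤ D, N.v i = N'.v i) (x : ℕ → ℝ) :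
    N.hidden x D = N'.hidden x D := by
  induction D with
  | zero => funext j; simp [hidden, harch 0 le_rfl, hW 0 le_rfl]
  | succ D ih =>
    have := ih (fun i hi => harch i (by omega)) (fun i hi => hW i (by omega))
      (fun i hi => hv i (by omega))
    funext j
    simp [hidden, this, harch (D + 1) le_rfl, hW (D + 1) le_rfl, hv (D + 1) le_rfl]

end ReQUNet

/-- `y` is the output of a ReQU network with `D` hidden layers on `d` inputs, with weights in
`[-1, 1]`, width at most `w` and at most `c` nonzero weights. -/
def NetOut (d D w c : ℕ) {ι : Type} [Fintype ι] (y : (ℕ → ℝ) → ι → ℝ) : Prop :=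
  ∀ e : ι ≃ Fin (Fintype.card ι), ∃ N : ReQUNet, N.arch (D + 1) = Fintype.card ι ∧ N.L = D ∧
    N.arch 0 = d ∧ N.width ≤ w ∧ N.weightsIn (Set.Icc (-1) 1) ∧ N.numNonzero ≤ c ∧
    ∀ x i, N.eval x (e i) = y x i

/-- Reads a matrix with finite index types as a matrix indexed by natural numbers. -/
noncomputable def natMatrix {ι κ : Type} {m n : ℕ} (e : ι ≃ Fin m) (e' : κ ≃ Fin n)
    (A : ι → κ → ℝ) (i j : ℕ) : ℝ :=
  if h : i < m ∧ j < n then A (e.symm ⟨i, h.1⟩) (e'.symm ⟨j, h.2⟩) else 0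

lemma natMatrix_apply {ι κ : Type} {m n : ℕ} (e : ι ≃ Fin m) (e' : κ ≃ Fin n)
    (A : ι → κ → ℝ) (i : ι) (j : κ) : natMatrix e e' A (e i) (e' j) = A i j := by
  simp [natMatrix]

lemma natMatrix_mem {ι κ : Type} {m n : ℕ} (e : ι ≃ Fin m) (e' : κ ≃ Fin n)
    {A : ι → κ → ℝ} (hA : ∀ i j, |A i j| ≤ 1) (i j : ℕ) :
    natMatrix e e' A i j ∈ Set.Icc (-1 : ℝ) 1 := by
  unfold natMatrix
  split_ifs with h
  · exact abs_le.1 (hA _ _)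
  · simp

lemma card_natMatrix_ne_zero_le {ι κ : Type} [Fintype ι] [Fintype κ] {m n : ℕ} (e : ι ≃ Fin m)
    (e' : κ ≃ Fin n) {A : ι → κ → ℝ} {r : ℕ}
    (hA : ∀ i, (Finset.univ.filter fun j => A i j ≠ 0).card ≤ r) :
    ((Finset.range m ×ˢ Finset.range n).filter
      fun p => natMatrix e e' A p.1 p.2 ≠ 0).card ≤ Fintype.card ι * r := by
  calc _ ≤ ((Finset.univ : Finset ι).sigma fun i =>
        Finset.univ.filter fun j => A i j ≠ 0).card := by
        refine Finset.card_le_card_of_surjOn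
          (fun p : (Σ _ : ι, κ) => ((e p.1 : ℕ), (e' p.2 : ℕ))) ?_
        rintro ⟨i, j⟩ hij
        simp only [Finset.coe_filter, Finset.mem_product, Finset.mem_range, Set.mem_ofPred_eq]
          at hij
        obtain ⟨⟨hi, hj⟩, h⟩ := hij
        refine ⟨⟨e.symm ⟨i, hi⟩, e'.symm ⟨j, hj⟩⟩, ?_, by simp⟩
        simpa [natMatrix, hi, hj] using h
    _ ≤ _ := by
        rw [Finset.card_sigma]
        calc _ ≤ ∑ _i : ι, r := Finset.sum_le_sum fun i _ => hA i
          _ = _ := by simp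

lemma sum_range_equiv {κ : Type} [Fintype κ] {n : ℕ} (e : κ ≃ Fin n) (g : ℕ → ℝ) :
    ∑ k ∈ Finset.range n, g k = ∑ j, g (e j) := by
  rw [Finset.sum_range]
  exact (Equiv.sum_comp e fun k : Fin n => g k).symm

lemma netOut_linear {d w r : ℕ} {ι : Type} [Fintype ι] (A : ι → Fin d → ℝ)
    (hA : ∀ i j, |A i j| ≤ 1) (hr : ∀ i, (Finset.univ.filter fun j => A i j ≠ 0).card ≤ r)
    (hd : d ≤ w) (hι : Fintype.card ι ≤ w) :
    NetOut d 0 w (Fintype.card ι * r) fun x i => ∑ k : Fin d, A i k * x k := by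
  intro e
  let N : ReQUNet :=
    { L := 0
      arch := fun i => if i = 0 then d else Fintype.card ι
      W := fun _ => natMatrix e (Equiv.refl (Fin d)) A
      v := fun _ _ => 0 }
  refine ⟨N, rfl, rfl, rfl, ?_, ⟨fun i _ j _ k _ => natMatrix_mem _ _ hA _ _, ?_⟩, ?_, ?_⟩
  · refine Finset.sup_le fun i _ => ?_
    by_cases h : i = 0 <;> simp [N, h, hd, hι]
  · intro i _ _ j _
    simp [N]
  · simpa [ReQUNet.numNonzero, N] using
      card_natMatrix_ne_zero_le e (Equiv.refl (Fin d)) hr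
  · intro x i
    simp only [ReQUNet.eval, ReQUNet.hidden, N, if_true]
    rw [sum_range_equiv (Equiv.refl (Fin d))]
    exact Finset.sum_congr rfl fun k _ => by rw [natMatrix_apply]; simp

lemma NetOut.layer {d D w c r : ℕ} {ι κ : Type} [Fintype ι] [Fintype κ]
    {y : (ℕ → ℝ) → ι → ℝ} (h : NetOut d D w c y) (b : ι → ℝ) (A : κ → ι → ℝ)
    (hb : ∀ i, |b i| ≤ 1) (hA : ∀ k i, |A k i| ≤ 1)
    (hr : ∀ k, (Finset.univ.filter fun i => A k i ≠ 0).card ≤ r) (hκ : Fintype.card κ ≤ w) :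
    NetOut d (D + 1) w (c + Fintype.card ι + Fintype.card κ * r)
      fun x k => ∑ i, A k i * requ (y x i - b i) := by
  intro e'
  obtain ⟨N, hN, hL, hd, hw, hW, hc, hy⟩ := h (Fintype.equivFin ι)
  let e : ι ≃ Fin (N.arch (D + 1)) := (Fintype.equivFin ι).trans (finCongr hN.symm)
  let N' : ReQUNet :=
    { L := D + 1
      arch := fun i => if i = D + 2 then Fintype.card κ else N.arch i
      W := fun i => if i = D + 1 then natMatrix e' e A else N.W i
      v := fun i => if i = D + 1 then
          fun j => natMatrix (Equiv.refl (Fin 1)) e (fun _ => b) 0 j else N.v i }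
  have harch : ∀ i ≤ D + 1, N'.arch i = N.arch i := fun i hi => by
    simp [N', show i ≠ D + 2 by omega]
  have harch' : N'.arch (D + 2) = Fintype.card κ := by simp [N']
  have hWe : ∀ i ≤ D, N'.W i = N.W i := fun i hi => by simp [N', show i ≠ D + 1 by omega]
  have hve : ∀ i ≤ D, N'.v i = N.v i := fun i hi => by simp [N', show i ≠ D + 1 by omega]
  have hW1 : N'.W (D + 1) = natMatrix e' e A := by simp [N']
  have hv1 : N'.v (D + 1) = fun j => natMatrix (Equiv.refl (Fin 1)) e (fun _ => b) 0 j := by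
    simp [N']
  have hmemv : ∀ j, N'.v (D + 1) j ∈ Set.Icc (-1 : ℝ) 1 := fun j => by
    rw [hv1]; exact natMatrix_mem _ _ (fun _ i => hb i) _ _
  refine ⟨N', harch', rfl,
    by rw [harch 0 (by omega), hd], ?_, ⟨?_, ?_⟩, ?_, ?_⟩
  · refine Finset.sup_le fun i hi => ?_
    by_cases h : i = D + 2
    · rw [h, harch']; exact hκ
    · have hi' : i < D + 3 := by simpa [N'] using hi
      rw [harch i (by omega)]
      refine le_trans ?_ hw
      exact Finset.le_sup (f := N.arch) (Finset.mem_range.2 (by omega))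
  · intro i hi j hj k hk
    rcases Nat.lt_or_eq_of_le (show i ≤ D + 1 from hi) with h | h
    · rw [hWe i (by omega)]
      exact hW.1 i (by omega) j (by rwa [harch (i + 1) (by omega)] at hj) k
        (by rwa [harch i (by omega)] at hk)
    · subst h
      rw [hW1]
      exact natMatrix_mem _ _ hA _ _
  · intro i hi1 hi j hj
    rcases Nat.lt_or_eq_of_le (show i ≤ D + 1 from hi) with h | h
    · rw [hve i (by omega)]
      exact hW.2 i hi1 (by omega) j (by rwa [harch i (by omega)] at hj)
    · subst h
      exact hmemv j
  · have h1 : ((Finset.range (N'.arch (D + 2)) ×ˢ Finset.range (N'.arch (D + 1))).filter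
        fun p => N'.W (D + 1) p.1 p.2 ≠ 0).card ≤ Fintype.card κ * r := by
      rw [harch', harch (D + 1) le_rfl, hW1]
      exact card_natMatrix_ne_zero_le e' e hr
    have h2 : ((Finset.range (N'.arch (D + 1))).filter fun j => N'.v (D + 1) j ≠ 0).card ≤
        Fintype.card ι := by
      refine (Finset.card_filter_le _ _).trans ?_
      rw [harch (D + 1) le_rfl, Finset.card_range, Fintype.card_congr e, Fintype.card_fin]
    have h3 : N'.numNonzero = N.numNonzero +
        ((Finset.range (N'.arch (D + 1))).filter fun j => N'.v (D + 1) j ≠ 0).card +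
        ((Finset.range (N'.arch (D + 2)) ×ˢ Finset.range (N'.arch (D + 1))).filter
          fun p => N'.W (D + 1) p.1 p.2 ≠ 0).card := by
      simp only [ReQUNet.numNonzero, hL, show N'.L = D + 1 from rfl]
      rw [Finset.sum_range_succ _ (D + 1),
        ← Finset.insert_Icc_right_eq_Icc_add_one (show 1 ≤ D + 1 by omega),
        Finset.sum_insert (by simp)]
      have e1 : ∀ i ∈ Finset.range (D + 1),
          ((Finset.range (N'.arch (i + 1)) ×ˢ Finset.range (N'.arch i)).filter
            fun p => N'.W i p.1 p.2 ≠ 0).card =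
          ((Finset.range (N.arch (i + 1)) ×ˢ Finset.range (N.arch i)).filter
            fun p => N.W i p.1 p.2 ≠ 0).card := fun i hi => by
        have := Finset.mem_range.1 hi
        rw [harch i (by omega), harch (i + 1) (by omega), hWe i (by omega)]
      have e2 : ∀ i ∈ Finset.Icc 1 D,
          ((Finset.range (N'.arch i)).filter fun j => N'.v i j ≠ 0).card =
          ((Finset.range (N.arch i)).filter fun j => N.v i j ≠ 0).card := fun i hi => by
        have := Finset.mem_Icc.1 hi
        rw [harch i (by omega), hve i (by omega)]
      rw [Finset.sum_congr rfl e1, Finset.sum_congr rfl e2]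
      ring
    omega
  · intro x k
    have hh : N'.hidden x D = N.hidden x D :=
      ReQUNet.hidden_congr (fun i hi => harch i (by omega)) hWe hve x
    simp only [ReQUNet.eval, show N'.L = D + 1 from rfl, ReQUNet.hidden, hh]
    rw [harch (D + 1) le_rfl, sum_range_equiv e]
    refine Finset.sum_congr rfl fun i _ => ?_
    rw [hW1, hv1]
    have : N.eval x (e i) = y x i := hy x i
    rw [ReQUNet.eval, hL] at this
    rw [this]
    have h2 := natMatrix_apply (Equiv.refl (Fin 1)) e (fun _ => b) 0 i
    simp only [Equiv.refl_apply, Fin.val_zero] at h2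
    beta_reduce
    rw [h2]
    have h3 := natMatrix_apply e' e A k i
    simpa using congrArg (· * requ (y x i - b i)) h3

/-- The features `F` are linear readouts of the neurons of the last hidden layer of a ReQU network
with `D + 1` hidden layers, where every feature reads at most four neurons. -/
def FeatureNet (d D w c : ℕ) {κ : Type} [Fintype κ] (F : (ℕ → ℝ) → κ → ℝ) : Prop :=
  ∃ (ι : Type) (_ : Fintype ι) (y : (ℕ → ℝ) → ι → ℝ) (b : ι → ℝ) (O : κ → ι → ℝ) (c' : ℕ),
    NetOut d D w c' y ∧ c' + Fintype.card ι ≤ c ∧ (∀ i, |b i| ≤ 1) ∧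
    (∀ i, ∑ k, |O k i| ≤ 1 / 4) ∧
    (∀ k, (Finset.univ.filter fun i => O k i ≠ 0).card ≤ 4) ∧
    ∀ x k, F x k = ∑ i, O k i * requ (y x i - b i)

/-- `g` is a combination, with coefficients at most `1 / 4`, of four neurons fed with
affine forms in the features `F`, each of which involves at most `m` features. -/
def Gate (m : ℕ) {κ : Type} [Fintype κ] (F : (ℕ → ℝ) → κ → ℝ) (g : (ℕ → ℝ) → ℝ) : Prop :=
  ∃ (a : Fin 4 → κ → ℝ) (b o : Fin 4 → ℝ), (∀ r k, |a r k| ≤ 4) ∧ (∀ r, |b r| ≤ 1) ∧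
    (∀ r, |o r| ≤ 1 / 4) ∧ (∀ r, (Finset.univ.filter fun k => a r k ≠ 0).card ≤ m) ∧
    ∀ x, g x = ∑ r, o r * requ (∑ k, a r k * F x k - b r)

lemma FeatureNet.mono {d D w c c' : ℕ} {κ : Type} [Fintype κ] {F : (ℕ → ℝ) → κ → ℝ}
    (h : FeatureNet d D w c F) (hc : c ≤ c') : FeatureNet d D w c' F := by
  obtain ⟨ι, _, y, b, O, c₀, h1, h2, h3⟩ := h
  exact ⟨ι, _, y, b, O, c₀, h1, h2.trans hc, h3⟩

lemma FeatureNet.comp_injective {d D w c : ℕ} {κ κ' : Type} [Fintype κ] [Fintype κ']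
    {F : (ℕ → ℝ) → κ → ℝ} (h : FeatureNet d D w c F) (e : κ' → κ) (he : Function.Injective e) :
    FeatureNet d D w c fun x k => F x (e k) := by
  obtain ⟨ι, _, y, b, O, c₀, h1, h2, h3, h4, h5, h6⟩ := h
  refine ⟨ι, _, y, b, fun k => O (e k), c₀, h1, h2, h3, fun i => ?_, fun k => h5 _,
    fun x k => h6 x _⟩
  refine le_trans ?_ (h4 i)
  calc ∑ k, |O (e k) i| = ∑ k ∈ Finset.univ.map ⟨e, he⟩, |O k i| := by simp
    _ ≤ _ := Finset.sum_le_sum_of_subset_of_nonneg (Finset.subset_univ _)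
      fun _ _ _ => abs_nonneg _

lemma card_filter_sum_mul_ne_zero_le {κ ι : Type} [Fintype κ] [Fintype ι] {m r : ℕ} (a : κ → ℝ)
    (O : κ → ι → ℝ) (ha : (Finset.univ.filter fun k => a k ≠ 0).card ≤ m)
    (hO : ∀ k, (Finset.univ.filter fun i => O k i ≠ 0).card ≤ r) :
    (Finset.univ.filter fun i => ∑ k, a k * O k i ≠ 0).card ≤ m * r := by
  calc _ ≤ ((Finset.univ.filter fun k => a k ≠ 0).biUnion fun k =>
        Finset.univ.filter fun i => O k i ≠ 0).card := by
        refine Finset.card_le_card fun i hi => ?_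
        obtain ⟨k, -, hk⟩ := Finset.exists_ne_zero_of_sum_ne_zero (Finset.mem_filter.1 hi).2
        simp only [Finset.mem_biUnion, Finset.mem_filter, Finset.mem_univ, true_and]
        exact ⟨k, left_ne_zero_of_mul hk, right_ne_zero_of_mul hk⟩
    _ ≤ (Finset.univ.filter fun k => a k ≠ 0).card * r :=
        Finset.card_biUnion_le_card_mul _ _ _ fun k _ => hO k
    _ ≤ m * r := Nat.mul_le_mul_right _ ha

lemma abs_sum_mul_le_one {κ : Type} [Fintype κ] (a o : κ → ℝ) (ha : ∀ k, |a k| ≤ 4)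
    (ho : ∑ k, |o k| ≤ 1 / 4) : |∑ k, a k * o k| ≤ 1 := by
  calc |∑ k, a k * o k| ≤ ∑ k, |a k * o k| := Finset.abs_sum_le_sum_abs _ _
    _ ≤ ∑ k, 4 * |o k| := Finset.sum_le_sum fun k _ => by
        rw [abs_mul]; exact mul_le_mul_of_nonneg_right (ha k) (abs_nonneg _)
    _ ≤ 1 := by rw [← Finset.mul_sum]; linarith

lemma sum_mul_readout {κ ι : Type} [Fintype κ] [Fintype ι] (a : κ → ℝ) (O : κ → ι → ℝ)
    (z : ι → ℝ) (F : κ → ℝ) (hF : ∀ k, F k = ∑ i, O k i * z i) :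
    ∑ i, (∑ k, a k * O k i) * z i = ∑ k, a k * F k := by
  simp only [hF, Finset.mul_sum, Finset.sum_mul]
  rw [Finset.sum_comm]
  simp only [mul_assoc]

/-- The weights with which gates read their own four neurons. -/
noncomputable def gateReadout {κ : Type} (o : κ → Fin 4 → ℝ) (k : κ) (p : κ × Fin 4) : ℝ :=
  if p.1 = k then o k p.2 else 0

lemma sum_gateReadout_mul {κ : Type} [Fintype κ] (o : κ → Fin 4 → ℝ) (k : κ)
    (z : κ × Fin 4 → ℝ) : ∑ p, gateReadout o k p * z p = ∑ r, o k r * z (k, r) := by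
  simp [gateReadout, Fintype.sum_prod_type]

lemma sum_abs_gateReadout_le {κ : Type} [Fintype κ] {o : κ → Fin 4 → ℝ}
    (ho : ∀ k r, |o k r| ≤ 1 / 4) (p : κ × Fin 4) : ∑ k, |gateReadout o k p| ≤ 1 / 4 := by
  have : ∀ k, |gateReadout o k p| = if p.1 = k then |o k p.2| else 0 := fun k => by
    unfold gateReadout; split_ifs <;> simp
  simp only [this, Finset.sum_ite_eq, Finset.mem_univ, if_true]
  exact ho _ _

lemma card_gateReadout_ne_zero_le {κ : Type} [Fintype κ] (o : κ → Fin 4 → ℝ) (k : κ) :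
    (Finset.univ.filter fun p => gateReadout o k p ≠ 0).card ≤ 4 := by
  calc _ ≤ (({k} : Finset κ) ×ˢ (Finset.univ : Finset (Fin 4))).card := by
        refine Finset.card_le_card fun p hp => ?_
        have := (Finset.mem_filter.1 hp).2
        unfold gateReadout at this
        simp only [Finset.mem_product, Finset.mem_singleton, Finset.mem_univ, and_true]
        by_contra h
        exact this (if_neg h)
    _ = 4 := by simp

lemma FeatureNet.gates {d D w c m : ℕ} {κ κ' : Type} [Fintype κ] [Fintype κ']
    {F : (ℕ → ℝ) → κ → ℝ} (h : FeatureNet d D w c F) (F' : (ℕ → ℝ) → κ' → ℝ)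
    (hg : ∀ k, Gate m F fun x => F' x k) (hw : 4 * Fintype.card κ' ≤ w) :
    FeatureNet d (D + 1) w (c + Fintype.card κ' * (16 * m + 4)) F' := by
  obtain ⟨ι, _, y, b, O, c₀, h1, h2, h3, h4, h5, h6⟩ := h
  choose a b' o ha hb' ho hm hF' using hg
  have hcard : Fintype.card (κ' × Fin 4) = 4 * Fintype.card κ' := by
    rw [Fintype.card_prod, Fintype.card_fin, mul_comm]
  refine ⟨κ' × Fin 4, inferInstance, fun x p => ∑ k, a p.1 p.2 k * F x k, fun p => b' p.1 p.2,
    gateReadout o, c₀ + Fintype.card ι + Fintype.card (κ' × Fin 4) * (m * 4), ?_, ?_,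
    fun p => hb' _ _, sum_abs_gateReadout_le ho, card_gateReadout_ne_zero_le o, ?_⟩
  · have := h1.layer b (fun (p : κ' × Fin 4) i => ∑ k, a p.1 p.2 k * O k i) h3
      (fun p i => abs_sum_mul_le_one _ _ (ha _ _) (h4 i))
      (fun p => card_filter_sum_mul_ne_zero_le _ _ (hm _ _) h5) (by rw [hcard]; exact hw)
    convert this using 3 with x p
    exact (sum_mul_readout _ O (fun i => requ (y x i - b i)) (F x) (h6 x)).symm
  · rw [hcard]; nlinarith
  · intro x k
    rw [sum_gateReadout_mul]; exact hF' k x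

lemma FeatureNet.output {d D w c m : ℕ} {κ ι : Type} [Fintype κ] [Fintype ι]
    {F : (ℕ → ℝ) → κ → ℝ} (h : FeatureNet d D w c F) (a : ι → κ → ℝ)
    (ha : ∀ i k, |a i k| ≤ 4) (hm : ∀ i, (Finset.univ.filter fun k => a i k ≠ 0).card ≤ m)
    (hι : Fintype.card ι ≤ w) :
    NetOut d (D + 1) w (c + Fintype.card ι * (m * 4)) fun x i => ∑ k, a i k * F x k := by
  obtain ⟨ι₀, _, y, b, O, c₀, h1, h2, h3, h4, h5, h6⟩ := h
  have := h1.layer b (fun i j => ∑ k, a i k * O k j) h3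
    (fun p i => abs_sum_mul_le_one _ _ (ha _) (h4 i))
    (fun p => card_filter_sum_mul_ne_zero_le _ _ (hm _) h5) hι
  intro e
  obtain ⟨N, hN, hL, hd, hw, hW, hc, hy⟩ := this e
  refine ⟨N, hN, hL, hd, hw, hW, hc.trans (by omega), fun x i => (hy x i).trans ?_⟩
  exact sum_mul_readout _ O (fun i => requ (y x i - b i)) (F x) (h6 x)

lemma featureNet_of_inputs {d w r : ℕ} {κ : Type} [Fintype κ] (A : κ → Fin 4 → Fin d → ℝ)
    (b o : κ → Fin 4 → ℝ) (hA : ∀ k r j, |A k r j| ≤ 1) (hb : ∀ k r, |b k r| ≤ 1)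
    (ho : ∀ k r, |o k r| ≤ 1 / 4)
    (hr : ∀ k i, (Finset.univ.filter fun j => A k i j ≠ 0).card ≤ r)
    (hd : d ≤ w) (hκ : 4 * Fintype.card κ ≤ w) :
    FeatureNet d 0 w (Fintype.card κ * (4 * r + 4)) fun x k =>
      ∑ i, o k i * requ (∑ j : Fin d, A k i j * x j - b k i) := by
  have hcard : Fintype.card (κ × Fin 4) = 4 * Fintype.card κ := by
    rw [Fintype.card_prod, Fintype.card_fin, mul_comm]
  refine ⟨κ × Fin 4, inferInstance, fun x p => ∑ j : Fin d, A p.1 p.2 j * x j,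
    fun p => b p.1 p.2, gateReadout o, _,
    netOut_linear (fun p : κ × Fin 4 => A p.1 p.2) (fun p => hA _ _) (fun p => hr _ _) hd
      (by rw [hcard]; exact hκ), ?_, fun p => hb _ _, sum_abs_gateReadout_le ho,
    card_gateReadout_ne_zero_le o, ?_⟩
  · rw [hcard]; nlinarith
  · intro x k
    rw [sum_gateReadout_mul]

/-- The signs of the four neurons that multiply two numbers. -/
noncomputable def mulSign (r : Fin 4) : ℝ := if r = 0 ∨ r = 1 then 1 / 4 else -(1 / 4)

/-- The forms `p` and `q`, combined as in the four neurons that multiply two numbers. -/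
def mulForm (p q : ℝ) : Fin 4 → ℝ := ![p + q, -(p + q), p - q, -(p - q)]

lemma requ_add_requ_neg (t : ℝ) : requ t + requ (-t) = t ^ 2 := by
  unfold requ
  rcases le_total t 0 with h | h
  · rw [max_eq_right h, max_eq_left (by linarith)]; ring
  · rw [max_eq_left h, max_eq_right (by linarith)]; ring

lemma sum_mulSign_requ_mulForm (p q : ℝ) : ∑ r, mulSign r * requ (mulForm p q r) = p * q := by
  have h1 := requ_add_requ_neg (p + q)
  have h2 := requ_add_requ_neg (p - q)
  simp only [Fin.sum_univ_four, mulSign, mulForm, Fin.isValue]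
  simp only [Matrix.cons_val, Fin.reduceEq, or_false, false_or, or_self, if_true, if_false]
  linear_combination (1 / 4 : ℝ) * h1 - (1 / 4 : ℝ) * h2

lemma abs_mulSign_le (r : Fin 4) : |mulSign r| ≤ 1 / 4 := by
  unfold mulSign; split_ifs <;> norm_num

lemma abs_mulForm_le (p q : ℝ) (r : Fin 4) : |mulForm p q r| ≤ |p| + |q| := by
  fin_cases r <;> simp only [mulForm, Matrix.cons_val, Fin.reduceFinMk, abs_neg] <;>
    first | exact abs_add_le _ _ | exact abs_sub _ _

lemma sum_mulForm {κ : Type} [Fintype κ] (α β z : κ → ℝ) (a₀ b₀ : ℝ) (r : Fin 4) :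
    ∑ k, mulForm (α k) (β k) r * z k - mulForm (-a₀) (-b₀) r =
      mulForm (∑ k, α k * z k + a₀) (∑ k, β k * z k + b₀) r := by
  fin_cases r <;>
    simp [mulForm, add_mul, sub_mul, neg_mul, Finset.sum_add_distrib, Finset.sum_sub_distrib,
      Finset.sum_neg_distrib] <;> ring

lemma gate_mul_of_forms {m : ℕ} {κ : Type} [Fintype κ] {F : (ℕ → ℝ) → κ → ℝ} (α β : κ → ℝ)
    (a₀ b₀ : ℝ) (h : ∀ k, |α k| + |β k| ≤ 4) (h₀ : |a₀| + |b₀| ≤ 1) (T : Finset κ)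
    (hT : T.card ≤ m) (hα : ∀ k ∉ T, α k = 0) (hβ : ∀ k ∉ T, β k = 0) {g : (ℕ → ℝ) → ℝ}
    (hg : ∀ x, g x = (∑ k, α k * F x k + a₀) * (∑ k, β k * F x k + b₀)) : Gate m F g := by
  refine ⟨fun r k => mulForm (α k) (β k) r, fun r => mulForm (-a₀) (-b₀) r, mulSign,
    fun r k => (abs_mulForm_le _ _ _).trans (h k),
    fun r => (abs_mulForm_le _ _ _).trans (by simpa using h₀), abs_mulSign_le,
    fun r => (Finset.card_le_card fun k hk => ?_).trans hT, fun x => ?_⟩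
  · by_contra hkT
    refine (Finset.mem_filter.1 hk).2 ?_
    change mulForm (α k) (β k) r = 0
    have := abs_mulForm_le (α k) (β k) r
    rw [hα k hkT, hβ k hkT] at this ⊢
    simpa using this
  · simp only [sum_mulForm, sum_mulSign_requ_mulForm, hg]

lemma gate_requ_of_form {m : ℕ} {κ : Type} [Fintype κ] {F : (ℕ → ℝ) → κ → ℝ} (α : κ → ℝ)
    (h : ∀ k, |α k| ≤ 4) (T : Finset κ) (hT : T.card ≤ m) (hα : ∀ k ∉ T, α k = 0)
    {g : (ℕ → ℝ) → ℝ} (hg : ∀ x, g x = requ (∑ k, α k * F x k)) : Gate m F g := by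
  refine ⟨fun _ => α, fun _ => 0, fun _ => 1 / 4, fun _ => h, by simp,
    fun _ => (abs_of_nonneg (by norm_num)).le,
    fun r => (Finset.card_le_card fun k hk => ?_).trans hT, fun x => ?_⟩
  · by_contra hkT
    exact (Finset.mem_filter.1 hk).2 (hα k hkT)
  · rw [hg]; simp

lemma abs_single_sub_single_le {κ : Type} {k l : κ} {t : ℝ} (ht : |t| ≤ 1) (j : κ) :
    |(Pi.single k (1 : ℝ) - Pi.single l t : κ → ℝ) j| ≤ 2 := by
  rw [Pi.sub_apply]
  refine (abs_sub _ _).trans ?_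
  have h1 : |(Pi.single k (1 : ℝ) : κ → ℝ) j| ≤ 1 := by
    rw [Pi.single_apply]; split_ifs <;> simp
  have h2 : |(Pi.single l t : κ → ℝ) j| ≤ 1 := by
    rw [Pi.single_apply]; split_ifs <;> simp [ht]
  linarith

section Gates

variable {κ : Type} [Fintype κ] (F : (ℕ → ℝ) → κ → ℝ)

lemma gate_id {m : ℕ} (hm : 1 ≤ m) (k : κ) : Gate m F fun x => F x k := by
  refine gate_mul_of_forms (Pi.single k 1) 0 0 1 (fun j => ?_) (by simp) {k} (by simpa) ?_
    (by simp) fun x => ?_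
  · by_cases h : j = k <;> simp [h]
  · intro j hj
    simpa [Pi.single_apply] using hj
  · simp [Pi.single_apply]

lemma gate_mul {m : ℕ} (hm : 2 ≤ m) (k l : κ) : Gate m F fun x => F x k * F x l := by
  refine gate_mul_of_forms (Pi.single k 1) (Pi.single l 1) 0 0 (fun j => ?_) (by simp) {k, l}
    (Finset.card_le_two.trans hm) ?_ ?_ fun x => ?_
  · by_cases h : j = k <;> by_cases h' : j = l <;> simp [Pi.single_apply, h, h'] <;>
      split_ifs <;> norm_num
  · intro j hj
    simp only [Finset.mem_insert, Finset.mem_singleton, not_or] at hj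
    simp [hj.1]
  · intro j hj
    simp only [Finset.mem_insert, Finset.mem_singleton, not_or] at hj
    simp [hj.2]
  · simp [Pi.single_apply]

lemma gate_sum_sq (T : Finset κ) {m : ℕ} (hm : T.card ≤ m) :
    Gate m F fun x => (2 * ∑ k ∈ T, F x k) ^ 2 := by
  refine gate_mul_of_forms (fun k => if k ∈ T then 2 else 0) (fun k => if k ∈ T then 2 else 0)
    0 0 (fun j => ?_) (by simp) T hm (fun k hk => if_neg hk) (fun k hk => if_neg hk) fun x => ?_
  · split_ifs <;> norm_num
  · simp [ite_mul, Finset.mul_sum, sq]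

lemma sum_single_sub_single_mul (k l : κ) (t : ℝ) (z : κ → ℝ) :
    ∑ j, (Pi.single k (1 : ℝ) - Pi.single l t : κ → ℝ) j * z j = z k - t * z l := by
  simp [Pi.single_apply, sub_mul, Finset.sum_sub_distrib]

lemma gate_requ_sub {m : ℕ} (hm : 2 ≤ m) (k l : κ) {t : ℝ} (ht : |t| ≤ 1) :
    Gate m F fun x => requ (F x k - t * F x l) := by
  refine gate_requ_of_form (Pi.single k 1 - Pi.single l t) (fun j => ?_) {k, l}
    (Finset.card_le_two.trans hm) ?_ fun x => ?_
  · exact (abs_single_sub_single_le ht j).trans (by norm_num)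
  · intro j hj
    simp only [Finset.mem_insert, Finset.mem_singleton, not_or] at hj
    simp [hj.1, hj.2]
  · rw [sum_single_sub_single_mul]

lemma gate_mul_sub {m : ℕ} (hm : 3 ≤ m) (i k l : κ) {t : ℝ} (ht : |t| ≤ 1) :
    Gate m F fun x => F x i * (F x k - t * F x l) := by
  refine gate_mul_of_forms (Pi.single i 1) (Pi.single k 1 - Pi.single l t) 0 0 (fun j => ?_)
    (by simp) {i, k, l} (Finset.card_le_three.trans hm) ?_ ?_ fun x => ?_
  · have h1 : |(Pi.single i (1 : ℝ) : κ → ℝ) j| ≤ 1 := by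
      rw [Pi.single_apply]; split_ifs <;> simp
    have := abs_single_sub_single_le (k := k) (l := l) ht j
    linarith
  · intro j hj
    simp only [Finset.mem_insert, Finset.mem_singleton, not_or] at hj
    simp [hj.1]
  · intro j hj
    simp only [Finset.mem_insert, Finset.mem_singleton, not_or] at hj
    simp [hj.2.1, hj.2.2]
  · rw [sum_single_sub_single_mul]; simp [Pi.single_apply]

end Gates

section Products

variable {ν : Type} {d : ℕ}

/-- The product of the features `W i (J i)` over the indices `i` congruent to `r` modulo `2 ^ e`. -/
noncomputable def residueProd (W : (ℕ → ℝ) → Fin d → ν → ℝ) (e : ℕ) (x : ℕ → ℝ) (J : Fin d → ν)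
    (r : ℕ) : ℝ :=
  ∏ i : Fin d, if (i : ℕ) % 2 ^ e = r then W x i (J i) else 1

lemma residueProd_eq_mul (W : (ℕ → ℝ) → Fin d → ν → ℝ) {e r : ℕ} (hr : r < 2 ^ e) (x : ℕ → ℝ)
    (J : Fin d → ν) : residueProd W e x J r =
      residueProd W (e + 1) x J r * residueProd W (e + 1) x J (r + 2 ^ e) := by
  simp only [residueProd, ← Finset.prod_mul_distrib]
  refine Finset.prod_congr rfl fun i _ => ?_
  have h : (i : ℕ) % 2 ^ (e + 1) = i % 2 ^ e + 2 ^ e * (i / 2 ^ e % 2) := Nat.mod_pow_succ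
  have h1 : (i : ℕ) % 2 ^ e < 2 ^ e := Nat.mod_lt _ (by positivity)
  rcases Nat.mod_two_eq_zero_or_one (i / 2 ^ e) with h2 | h2
  · rw [h2] at h
    have h3 : ¬ (i : ℕ) % 2 ^ (e + 1) = r + 2 ^ e := by omega
    rw [if_neg h3, mul_one, h]
    simp
  · rw [h2] at h
    have h3 : ¬ (i : ℕ) % 2 ^ (e + 1) = r := by omega
    rw [if_neg h3, one_mul, h]
    simp

lemma residueProd_of_le (W : (ℕ → ℝ) → Fin d → ν → ℝ) {e : ℕ} (he : d ≤ 2 ^ e) (x : ℕ → ℝ)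
    (J : Fin d → ν) (r : ℕ) :
    residueProd W e x J r = if h : r < d then W x ⟨r, h⟩ (J ⟨r, h⟩) else 1 := by
  have h (i : Fin d) : (i : ℕ) % 2 ^ e = i := Nat.mod_eq_of_lt (i.2.trans_le he)
  simp only [residueProd, h]
  split_ifs with hr
  · rw [Finset.prod_eq_single (⟨r, hr⟩ : Fin d) (fun i _ hi => if_neg fun h' => hi (Fin.ext h'))
      (by simp), if_pos rfl]
  · exact Finset.prod_eq_one fun i _ => if_neg fun h' => hr (by have := i.2; omega)

lemma residueProd_zero (W : (ℕ → ℝ) → Fin d → ν → ℝ) (x : ℕ → ℝ) (J : Fin d → ν) :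
    residueProd W 0 x J 0 = ∏ i, W x i (J i) := by
  simp [residueProd, Nat.mod_one]

lemma FeatureNet.prod_of_residueProd [Fintype ν] {D w c e : ℕ} {W : (ℕ → ℝ) → Fin d → ν → ℝ}
    (h : FeatureNet d D w c fun x (k : (Fin d → ν) × Fin (2 ^ e)) => residueProd W e x k.1 k.2)
    (hw : 4 * Fintype.card ν ^ d * 2 ^ e ≤ 2 * w) :
    FeatureNet d (D + e) w (c + 36 * (Fintype.card ν ^ d * (2 ^ e - 1)))
      fun x (J : Fin d → ν) => ∏ i, W x i (J i) := by
  induction e generalizing D c with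
  | zero =>
    simp only [← residueProd_zero]
    exact ((h.comp_injective (fun J => (J, 0)) fun J J' hJ => (Prod.mk.inj hJ).1).mono
      (Nat.le_add_right _ _))
  | succ e ih =>
    have key := h.gates (m := 2)
      (fun x (k : (Fin d → ν) × Fin (2 ^ e)) => residueProd W e x k.1 k.2) (fun k => ?_) ?_
    · have := ih key (by rw [pow_succ] at hw; nlinarith)
      rw [show D + (e + 1) = D + 1 + e by omega]
      refine this.mono ?_
      have h2 : 1 ≤ 2 ^ e := Nat.one_le_two_pow
      obtain ⟨t, ht⟩ := Nat.exists_eq_add_of_le h2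
      rw [Fintype.card_prod, Fintype.card_fun, Fintype.card_fin, Fintype.card_fin, pow_succ, ht,
        show (1 + t) * 2 - 1 = (1 + t) + t by omega, show 1 + t - 1 = t by omega]
      apply le_of_eq; ring
    · simp only [residueProd_eq_mul W k.2.2]
      have h1 := k.2.2
      have h2 : 2 ^ (e + 1) = 2 ^ e * 2 := pow_succ 2 e
      exact gate_mul _ le_rfl ((k.1, ⟨k.2, by omega⟩) : (Fin d → ν) × Fin (2 ^ (e + 1)))
        (k.1, ⟨k.2 + 2 ^ e, by omega⟩)
    · rw [Fintype.card_prod, Fintype.card_fun, Fintype.card_fin, Fintype.card_fin]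
      rw [pow_succ] at hw
      linarith

lemma FeatureNet.prod [Fintype ν] {D w c : ℕ} {κ : Type} [Fintype κ] {F : (ℕ → ℝ) → κ → ℝ}
    (hd : 0 < d)
    (h : FeatureNet d D w c F) (sel : Fin d × ν → κ) (hsel : Function.Injective sel)
    (hw : 4 * d * Fintype.card ν ^ d ≤ w) :
    FeatureNet d (D + Nat.clog 2 d) w (c + 72 * d * Fintype.card ν ^ d)
      fun x (J : Fin d → ν) => ∏ i, F x (sel (i, J i)) := by
  set W : (ℕ → ℝ) → Fin d → ν → ℝ := fun x i j => F x (sel (i, j)) with hW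
  rcases Nat.eq_zero_or_pos (Nat.clog 2 d) with h0 | h0
  · rw [h0]
    have hd1 : d = 1 := by
      have := Nat.le_pow_clog (b := 2) (by norm_num) d
      rw [h0] at this; omega
    subst hd1
    have := h.comp_injective (fun J : Fin 1 → ν => sel (0, J 0)) fun J J' hJ => by
      have := (Prod.mk.inj (hsel hJ)).2
      funext i; rw [Subsingleton.elim i 0]; exact this
    simp only [Fin.prod_univ_one]
    exact this.mono (Nat.le_add_right _ _)
  · obtain ⟨e, he⟩ := Nat.exists_eq_add_of_lt h0
    rw [zero_add] at he
    have hle : d ≤ 2 ^ (e + 1) := he ▸ Nat.le_pow_clog (by norm_num) d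
    have hlt : 2 ^ e < d := by
      have := Nat.pow_pred_clog_lt_self (b := 2) (by norm_num) (x := d) (by
        by_contra h1
        have : d = 1 := by omega
        subst this; simp at h0)
      rwa [he] at this
    have hcard : Fintype.card ((Fin d → ν) × Fin (2 ^ e)) = Fintype.card ν ^ d * 2 ^ e := by
      rw [Fintype.card_prod, Fintype.card_fun, Fintype.card_fin, Fintype.card_fin]
    have hmul : Fintype.card ν ^ d * 2 ^ e ≤ Fintype.card ν ^ d * d :=
      Nat.mul_le_mul_left _ hlt.le
    have key := h.gates (m := 2)
      (fun x (k : (Fin d → ν) × Fin (2 ^ e)) => residueProd W e x k.1 k.2) (fun k => ?_)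
      (by rw [hcard]; nlinarith)
    · have := key.prod_of_residueProd (by nlinarith)
      rw [he, show D + (e + 1) = D + 1 + e by omega]
      refine this.mono ?_
      rw [hcard]
      have h2 : Fintype.card ν ^ d * (2 ^ e - 1) ≤ Fintype.card ν ^ d * d :=
        Nat.mul_le_mul_left _ (by omega)
      nlinarith
    · have h1 := k.2.2
      simp only [residueProd_eq_mul W h1, residueProd_of_le W hle]
      simp only [show (k.2 : ℕ) < d by omega, dif_pos]
      split_ifs with h2
      · exact gate_mul _ le_rfl _ _
      · simp only [mul_one]
        exact gate_id _ (by norm_num) _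

end Products

/-- The inputs, together with a constant. -/
def inputsAndConst (d : ℕ) (c : ℝ) (x : ℕ → ℝ) (k : Option (Fin d)) : ℝ :=
  k.elim c fun i => x i

/-- The inputs, together with copies of the constant `1`. -/
def inputsAndOnes (d n : ℕ) (x : ℕ → ℝ) (k : Fin d ⊕ Fin n) : ℝ :=
  k.elim (fun i : Fin d => x i) fun _ => 1

lemma featureNet_inputsAndOnes {d n w : ℕ} (hw : 4 * (d + n) ≤ w) :
    FeatureNet d 0 w (8 * (d + n)) (inputsAndOnes d n) := by
  have := featureNet_of_inputs (d := d) (r := 1) (w := w) (κ := Fin d ⊕ Fin n)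
    (fun k r j => k.elim (fun i => mulForm ((Pi.single i 1 : Fin d → ℝ) j) 0 r) fun _ => 0)
    (fun k r => k.elim (fun _ => mulForm (-0) (-1) r) fun _ => -1)
    (fun k r => k.elim (fun _ => mulSign r) fun _ => 1 / 4) (fun k r j => ?_) (fun k r => ?_)
    (fun k r => ?_) (fun k r => ?_) (by omega) (by simpa using hw)
  · have h := this.mono (c' := 8 * (d + n)) (by simp; omega)
    convert h using 3 with x k
    rcases k with i | i
    · simp only [Sum.elim_inl]
      have h0 := fun r => sum_mulForm (Pi.single i 1) (fun _ => 0) (fun j : Fin d => x j) 0 1 r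
      simp only [h0, sum_mulSign_requ_mulForm]
      simp [inputsAndOnes, Pi.single_apply]
    · simp [inputsAndOnes, requ]
  · rcases k with i | i
    · refine (abs_mulForm_le _ _ _).trans ?_
      rw [Pi.single_apply]; split_ifs <;> simp
    · simp
  · rcases k with i | i
    · exact (abs_mulForm_le _ _ _).trans (by simp)
    · simp
  · rcases k with i | i
    · exact abs_mulSign_le r
    · simp only [Sum.elim_inr]; exact (abs_of_nonneg (by norm_num)).le
  · rcases k with i | i
    · refine (Finset.card_le_card (t := {i}) fun j hj => ?_).trans (by simp)
      by_contra hji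
      refine (Finset.mem_filter.1 hj).2 ?_
      rw [Finset.mem_singleton] at hji
      have := abs_mulForm_le 0 0 r
      simpa [hji] using this
    · simp

lemma featureNet_inputsAndConst {d n w : ℕ} (hn : 1 ≤ n) (hw : 4 * (d + n) ≤ w) :
    FeatureNet d 1 w (8 * (d + n) + (d + 1) * (16 * n + 4)) (inputsAndConst d (4 * n ^ 2)) := by
  have := (featureNet_inputsAndOnes hw).gates (m := n) (inputsAndConst d (4 * n ^ 2))
    (fun k => ?_) (by simp; omega)
  · simpa using this
  · rcases k with _ | i
    · have := gate_sum_sq (inputsAndOnes d n)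
        (Finset.univ.map Function.Embedding.inr) (m := n) (by simp)
      convert this using 2 with x
      simp [inputsAndConst, inputsAndOnes]; ring
    · exact gate_id (inputsAndOnes d n) hn (Sum.inl i)

lemma FeatureNet.amplify {d D w c : ℕ} {C : ℝ} (h : FeatureNet d D w c (inputsAndConst d (C / 4)))
    (hw : 4 * (d + 1) ≤ w) (k : ℕ) :
    FeatureNet d (D + k) w (c + k * ((d + 1) * 20)) (inputsAndConst d (C ^ 2 ^ k / 4)) := by
  induction k with
  | zero => simpa using h
  | succ k ih =>
    have := ih.gates (m := 1) (inputsAndConst d (C ^ 2 ^ (k + 1) / 4)) (fun l => ?_)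
      (by simpa using hw)
    · refine this.mono (le_of_eq ?_)
      simp only [Fintype.card_option, Fintype.card_fin]; ring
    · rcases l with _ | i
      · have := gate_sum_sq (inputsAndConst d (C ^ 2 ^ k / 4)) {none} (m := 1) (by simp)
        convert this using 2 with x
        simp [inputsAndConst]; ring
      · exact gate_id (inputsAndConst d (C ^ 2 ^ k / 4)) le_rfl (some i)

/-- The products of the inputs with a constant, together with the constant itself, and the
truncated powers of degree `m + 2` at the given knots, scaled accordingly. -/
noncomputable def scaledPowers (d : ℕ) {ν : Type} (t : ν → ℝ) (z : ℝ) (m : ℕ) (x : ℕ → ℝ)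
    (k : Option (Fin d) ⊕ (Fin d × ν)) : ℝ :=
  k.elim (fun l => l.elim z fun i => z * x i)
    fun p => requ (z * x p.1 - t p.2 * z) * (z * x p.1 - t p.2 * z) ^ m

lemma FeatureNet.scaledPowers {d D w c : ℕ} {z : ℝ} {ν : Type} [Fintype ν] {t : ν → ℝ}
    (h : FeatureNet d D w c (inputsAndConst d z)) (ht : ∀ j, |t j| ≤ 1)
    (hw : 4 * (d * Fintype.card ν + d + 1) ≤ w) (m : ℕ) :
    FeatureNet d (D + 2 + m) w (c + (d + 1) * 36 +
      (d * Fintype.card ν + d + 1) * (36 + 52 * m)) (scaledPowers d t z m) := by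
  have hcard : Fintype.card (Option (Fin d) ⊕ (Fin d × ν)) = d * Fintype.card ν + d + 1 := by
    simp; ring
  induction m with
  | zero =>
    have h1 := h.gates (m := 2) (fun x (k : Option (Fin d)) => k.elim z fun i => z * x i)
      (fun k => ?_) (by simp; nlinarith)
    · have h2 := h1.gates (m := 2) (_root_.scaledPowers d t z 0) (fun k => ?_) (by rwa [hcard])
      · refine h2.mono (le_of_eq ?_)
        rw [hcard]; simp
      · rcases k with k | p
        · exact gate_id (fun x (k : Option (Fin d)) => k.elim z fun i => z * x i) (by norm_num) k
        · have := gate_requ_sub (fun x (k : Option (Fin d)) => k.elim z fun i => z * x i) (m := 2)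
            le_rfl (some p.1) none (ht p.2)
          simpa [_root_.scaledPowers] using this
    · rcases k with _ | i
      · exact gate_id (inputsAndConst d z) (by norm_num) none
      · exact gate_mul (inputsAndConst d z) le_rfl none (some i)
  | succ m ih =>
    have h2 := ih.gates (m := 3) (_root_.scaledPowers d t z (m + 1)) (fun k => ?_) (by rwa [hcard])
    · refine h2.mono (le_of_eq ?_)
      rw [hcard]; ring
    · rcases k with k | p
      · exact gate_id (_root_.scaledPowers d t z m) (by norm_num) (Sum.inl k)
      · have := gate_mul_sub (_root_.scaledPowers d t z m) (m := 3) le_rfl (Sum.inr p)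
          (Sum.inl (some p.1)) (Sum.inl none) (ht p.2)
        simpa [_root_.scaledPowers, pow_succ, mul_assoc] using this

/-- The `m`-th derivative of the truncated power `x ↦ (max (x - t) 0) ^ q`. -/
noncomputable def truncPow (q m : ℕ) (t x : ℝ) : ℝ :=
  if t ≤ x then q.descFactorial m * (x - t) ^ (q - m) else 0

lemma truncPow_zero_eq {q : ℕ} (hq : 2 ≤ q) (t x : ℝ) :
    truncPow q 0 t x = requ (x - t) * (x - t) ^ (q - 2) := by
  unfold truncPow requ
  split_ifs with h
  · rw [max_eq_left (by linarith), ← pow_add]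
    simp [Nat.add_sub_cancel' hq]
  · rw [max_eq_right (by linarith)]; simp

lemma requ_mul {z : ℝ} (hz : 0 ≤ z) (u : ℝ) : requ (z * u) = z ^ 2 * requ u := by
  unfold requ
  rw [← mul_pow, mul_max_of_nonneg _ _ hz, mul_zero]

lemma scaledPowers_inr {d : ℕ} {ν : Type} (t : ν → ℝ) {z : ℝ} (hz : 0 ≤ z) (m : ℕ) (x : ℕ → ℝ)
    (p : Fin d × ν) :
    scaledPowers d t z m x (Sum.inr p) = z ^ (m + 2) * truncPow (m + 2) 0 (t p.2) (x p.1) := by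
  rw [truncPow_zero_eq (by omega), Nat.add_sub_cancel]
  simp only [scaledPowers, Sum.elim_inr]
  rw [show z * x p.1 - t p.2 * z = z * (x p.1 - t p.2) by ring, requ_mul hz, mul_pow]
  ring

lemma exists_reQUNet_tensor {d p n m k w : ℕ} {ν : Type} [Fintype ν] (hd : 0 < d) (hn : 1 ≤ n)
    {t : ν → ℝ} (ht : ∀ j, |t j| ≤ 1) (C : Fin p → (Fin d → ν) → ℝ) {z : ℝ}
    (hz : z = (16 * n ^ 2) ^ 2 ^ k / 4) (hC : ∀ i J, |C i J| ≤ z ^ ((m + 2) * d))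
    (hw1 : 4 * (d + n) ≤ w) (hw2 : 4 * (d * Fintype.card ν + d + 1) ≤ w)
    (hw3 : 4 * d * Fintype.card ν ^ d ≤ w) (hp : p ≤ w) :
    ∃ N : ReQUNet, N.arch 0 = d ∧ N.arch (N.L + 1) = p ∧ N.width ≤ w ∧
      N.L = 4 + k + m + Nat.clog 2 d ∧ N.weightsIn (Set.Icc (-1) 1) ∧
      N.numNonzero ≤ 8 * (d + n) + (d + 1) * (16 * n + 4) + k * ((d + 1) * 20) + (d + 1) * 36 +
        (d * Fintype.card ν + d + 1) * (36 + 52 * m) + 72 * d * Fintype.card ν ^ d +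
        p * (Fintype.card ν ^ d * 4) ∧
      ∀ x (i : Fin p), N.evalVec d x i =
        ∑ J, C i J * ∏ l, truncPow (m + 2) 0 (t (J l)) (x l) := by
  have hz0 : 0 < z := by
    have : (0 : ℝ) < n := by exact_mod_cast hn
    rw [hz]; positivity
  have h1 := featureNet_inputsAndConst hn hw1
  rw [show (4 * n ^ 2 : ℝ) = 16 * n ^ 2 / 4 by ring] at h1
  have h2 := h1.amplify (by nlinarith) k
  rw [← hz] at h2
  have h3 := (h2.scaledPowers ht hw2 m).prod hd Sum.inr Sum.inr_injective hw3
  have h4 := h3.output (m := Fintype.card ν ^ d) (fun (i : Fin p) J => C i J / z ^ ((m + 2) * d))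
    (fun i J => ?_) (fun i => (Finset.card_filter_le _ _).trans (by simp)) (by simpa using hp)
  · obtain ⟨N, ha, hL, hd', hw', hW, hc, hy⟩ := h4 (finCongr (by simp))
    refine ⟨N, hd', by rw [hL, ha, Fintype.card_fin], hw', by rw [hL]; omega, hW,
      hc.trans (by simp), fun x i => ?_⟩
    have := hy (fun k => if h : k < d then x ⟨k, h⟩ else 0) i
    simp only [finCongr_apply, Fin.val_cast] at this
    rw [ReQUNet.evalVec, this]
    refine Finset.sum_congr rfl fun J _ => ?_
    simp only [scaledPowers_inr t hz0.le, Finset.prod_mul_distrib, Finset.prod_const,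
      Finset.card_univ, Fintype.card_fin, ← pow_mul, Fin.is_lt, dif_pos, Fin.eta]
    field_simp
  · rw [abs_div, abs_of_pos (pow_pos hz0 _), div_le_iff₀ (pow_pos hz0 _)]
    have := hC i J
    have := pow_pos hz0 ((m + 2) * d)
    linarith

section LagrangeCoefficients

open Polynomial

/-- The terms of the Taylor formula: the `γ`-th derivative of `u ^ a / a!`. -/
noncomputable def taylorTerm (a γ : ℕ) (u : ℝ) : ℝ :=
  if γ ≤ a then u ^ (a - γ) / (a - γ).factorial else 0

/-- The coefficients that represent `(x - y) ^ a / a!` by the powers `(x - v j) ^ q`. -/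
noncomputable def powerCoeff {q : ℕ} (v : Fin (q + 1) → ℝ) (j : Fin (q + 1)) (a : ℕ) (y : ℝ) : ℝ :=
  (-1) ^ (q - a) / q.factorial *
    (derivative^[q - a] (Lagrange.basis Finset.univ v j)).eval y

lemma sum_powerCoeff_mul_pow {q : ℕ} {v : Fin (q + 1) → ℝ} (hv : Function.Injective v)
    {a γ : ℕ} (ha : a ≤ q) (hγ : γ ≤ q) (x y : ℝ) :
    ∑ j, powerCoeff v j a y * (q.descFactorial γ * (x - v j) ^ (q - γ)) =
      taylorTerm a γ (x - y) := by
  have hdeg : ((C x - X : ℝ[X]) ^ (q - γ)).degree < (Finset.univ : Finset (Fin (q + 1))).card := by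
    rw [Finset.card_univ, Fintype.card_fin]
    refine (degree_pow_le _ _).trans_lt ?_
    have h1 : (C x - X : ℝ[X]).degree ≤ 1 := by
      refine (degree_sub_le _ _).trans (max_le (degree_C_le.trans (by norm_num)) degree_X_le)
    refine (nsmul_le_nsmul_right h1 _).trans_lt ?_
    rw [nsmul_one]
    exact_mod_cast (by omega : q - γ < q + 1)
  have h := congrArg (fun P : ℝ[X] => (derivative^[q - a] P).eval y)
    (Lagrange.eq_interpolate hv.injOn hdeg)
  simp only [Lagrange.interpolate_apply, iterate_derivative_sum, iterate_derivative_C_mul,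
    eval_finsetSum, eval_mul, eval_C, eval_pow, eval_sub, eval_X] at h
  have h2 : (C x - X : ℝ[X]) ^ (q - γ) = C ((-1) ^ (q - γ)) * (X - C x) ^ (q - γ) := by
    rw [C_pow, ← mul_pow]; congr 1; simp
  rw [h2, iterate_derivative_C_mul, iterate_derivative_X_sub_pow] at h
  simp only [eval_mul, eval_C, eval_natCast, eval_pow, eval_sub, eval_X, nsmul_eq_mul] at h
  have h3 : ∑ j, powerCoeff v j a y * (q.descFactorial γ * (x - v j) ^ (q - γ)) =
      (-1) ^ (q - a) / q.factorial * q.descFactorial γ * ∑ j, (x - v j) ^ (q - γ) *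
        (derivative^[q - a] (Lagrange.basis Finset.univ v j)).eval y := by
    rw [Finset.mul_sum]
    exact Finset.sum_congr rfl fun j _ => by unfold powerCoeff; ring
  rw [h3, ← h]
  unfold taylorTerm
  split_ifs with hle
  · have e1 : q - γ - (q - a) = a - γ := by omega
    have f1 : ((q - γ).factorial : ℝ) * q.descFactorial γ = q.factorial := by
      exact_mod_cast Nat.factorial_mul_descFactorial hγ
    have f2 : ((a - γ).factorial : ℝ) * (q - γ).descFactorial (q - a) = (q - γ).factorial := by
      have := Nat.factorial_mul_descFactorial (show q - a ≤ q - γ by omega)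
      rw [e1] at this
      exact_mod_cast this
    have f3 : (-1 : ℝ) ^ (q - a) * (-1) ^ (q - γ) = (-1) ^ (a - γ) := by
      rw [show q - γ = (q - a) + (a - γ) by omega, pow_add, ← mul_assoc, ← pow_add, ← two_mul]
      simp
    have f4 : (x - y) ^ (a - γ) = (-1) ^ (a - γ) * (y - x) ^ (a - γ) := by
      rw [← mul_pow]; congr 1; ring
    have g1 : (q.factorial : ℝ) ≠ 0 := by positivity
    have g2 : ((a - γ).factorial : ℝ) ≠ 0 := by positivity
    rw [e1, f4, ← f3]
    field_simp
    rw [← f1, ← f2]; ring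
  · have h0 : (q - γ).descFactorial (q - a) = 0 := Nat.descFactorial_eq_zero_iff_lt.2 (by omega)
    rw [h0]; simp

lemma sum_taylorTerm_mul_powerCoeff {q : ℕ} {v : Fin (q + 1) → ℝ} (hv : Function.Injective v)
    (j : Fin (q + 1)) {δ : ℕ} (hδ : δ ≤ q) (x y : ℝ) :
    ∑ a ∈ Finset.range (q + 1), taylorTerm δ a (y - x) * powerCoeff v j a y =
      powerCoeff v j δ x := by
  set P := derivative^[q - δ] (Lagrange.basis Finset.univ v j) with hP
  have hdeg : (taylor y P).natDegree < δ + 1 := by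
    rw [natDegree_taylor]
    have := natDegree_iterate_derivative (Lagrange.basis Finset.univ v j) (q - δ)
    rw [Lagrange.natDegree_basis hv.injOn (Finset.mem_univ _), Finset.card_univ,
      Fintype.card_fin] at this
    rw [hP]
    omega
  have h := eval_eq_sum_range' hdeg (x - y)
  rw [taylor_eval_sub, ← Finset.sum_range_reflect] at h
  rw [powerCoeff, ← hP, h, Finset.mul_sum,
    ← Finset.sum_subset (Finset.range_subset_range.2 (show δ + 1 ≤ q + 1 by omega))]
  · refine Finset.sum_congr rfl fun a ha => ?_
    have ha : a ≤ δ := by have := Finset.mem_range.1 ha; omega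
    rw [taylorTerm, if_pos ha, powerCoeff, show δ + 1 - 1 - a = δ - a by omega, taylor_coeff]
    have h1 : (derivative^[q - a] (Lagrange.basis Finset.univ v j)).eval y =
        (δ - a).factorial * (hasseDeriv (δ - a) P).eval y := by
      have := congrFun (factorial_smul_hasseDeriv (R := ℝ) (k := δ - a)) P
      rw [hP, ← Function.iterate_add_apply, show δ - a + (q - δ) = q - a by omega, ← hP] at this
      rw [← this]
      simp
    have f3 : (-1 : ℝ) ^ (q - a) = (-1) ^ (q - δ) * (-1) ^ (δ - a) := by
      rw [← pow_add]; congr 1; omega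
    have f4 : (x - y) ^ (δ - a) = (-1) ^ (δ - a) * (y - x) ^ (δ - a) := by
      rw [← mul_pow]; congr 1; ring
    have g2 : ((δ - a).factorial : ℝ) ≠ 0 := by positivity
    rw [h1, f3, f4]
    field_simp
  · intro a _ ha
    rw [taylorTerm, if_neg (by simpa using ha), zero_mul]

lemma abs_powerCoeff_le {q : ℕ} {v : Fin (q + 1) → ℝ} (hv : Function.Injective v)
    (j : Fin (q + 1)) {a : ℕ} (ha : a ≤ q) {y ρ : ℝ} (hρ : ∀ i, |y - v i| ≤ ρ) :
    |powerCoeff v j a y| ≤ ρ ^ a / a.factorial / ∏ i ∈ Finset.univ.erase j, |v j - v i| := by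
  have hcard : (Finset.univ : Finset (Fin (q + 1))).card = q + 1 := by simp
  have hdeg : (Lagrange.basis Finset.univ v j).degree <
      (Finset.univ : Finset (Fin (q + 1))).card := by
    rw [Lagrange.degree_basis hv.injOn (Finset.mem_univ _), hcard]
    exact_mod_cast Nat.lt_succ_self q
  have h := Lagrange.eval_iterate_derivative_eq_sum hv.injOn hdeg (k := q - a)
    (by rw [hcard]; omega) y
  rw [Finset.sum_eq_single j (fun i _ hi => by
      rw [Lagrange.eval_basis_of_ne hi.symm (Finset.mem_univ _)]; simp) (by simp),
    Lagrange.eval_basis_self hv.injOn (Finset.mem_univ _), hcard,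
    show q + 1 - (q - a + 1) = a by omega] at h
  have h2 : |∑ t ∈ (Finset.univ.erase j).powersetCard a, ∏ i ∈ t, (y - v i)| ≤
      q.choose a * ρ ^ a := by
    refine (Finset.abs_sum_le_sum_abs _ _).trans ?_
    have : ((Finset.univ.erase j).powersetCard a).card = q.choose a := by
      rw [Finset.card_powersetCard, Finset.card_erase_of_mem (Finset.mem_univ _), hcard]; simp
    rw [← this, ← nsmul_eq_mul]
    refine Finset.sum_le_card_nsmul _ _ _ fun t ht => ?_
    rw [Finset.abs_prod, ← (Finset.mem_powersetCard.1 ht).2, ← Finset.prod_const]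
    exact Finset.prod_le_prod (fun _ _ => abs_nonneg _) fun i _ => hρ i
  rw [powerCoeff, h, abs_mul, abs_mul, abs_mul, abs_div, abs_pow, abs_neg, abs_one, one_pow,
    abs_div, abs_one, Finset.abs_prod, Nat.abs_cast, Nat.abs_cast]
  set π := ∏ i ∈ Finset.univ.erase j, |v j - v i| with hπ
  have hπ0 : 0 ≤ π := Finset.prod_nonneg fun _ _ => abs_nonneg _
  have f1 : (q.choose a : ℝ) * a.factorial * (q - a).factorial = q.factorial := by
    exact_mod_cast Nat.choose_mul_factorial_mul_factorial ha
  have g1 : (q.factorial : ℝ) ≠ 0 := by positivity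
  calc _ ≤ 1 / (q.factorial : ℝ) * ((q - a).factorial * (1 / π * (q.choose a * ρ ^ a))) := by
        gcongr
    _ = ρ ^ a / a.factorial / π := by
        rw [← f1]
        have : (q.choose a : ℝ) ≠ 0 := by exact_mod_cast (Nat.choose_pos ha).ne'
        field_simp

end LagrangeCoefficients

/-- The nodes of the `β`-th block, which is to the left of `β / n`. -/
noncomputable def blockNode (q n β : ℕ) (j : Fin (q + 1)) : ℝ :=
  ((β : ℝ) - 1 + j / (q + 1)) / n

lemma blockNode_sub {q n : ℕ} (β : ℕ) (i j : Fin (q + 1)) :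
    blockNode q n β j - blockNode q n β i = ((j : ℝ) - i) / ((q + 1) * n) := by
  unfold blockNode
  rw [← sub_div, mul_comm, ← div_div, div_right_comm]
  congr 1
  ring

lemma blockNode_injective {q n : ℕ} (hn : 1 ≤ n) (β : ℕ) :
    Function.Injective (blockNode q n β) := by
  intro i j hij
  have h := blockNode_sub (q := q) (n := n) β i j
  have hn' : (0 : ℝ) < n := by exact_mod_cast hn
  rw [hij, sub_self, eq_comm, div_eq_zero_iff] at h
  have h' : (j : ℝ) - i = 0 := h.resolve_right (by positivity)
  exact Fin.ext (by exact_mod_cast (sub_eq_zero.1 h').symm)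

lemma le_blockNode {q n β : ℕ} (j : Fin (q + 1)) : ((β : ℝ) - 1) / n ≤ blockNode q n β j := by
  unfold blockNode
  have : (0 : ℝ) ≤ j / (q + 1) := by positivity
  gcongr
  linarith

lemma blockNode_lt {q n β : ℕ} (hn : 1 ≤ n) (j : Fin (q + 1)) : blockNode q n β j < β / n := by
  unfold blockNode
  have hn' : (0 : ℝ) < n := by exact_mod_cast hn
  have : (j : ℝ) / (q + 1) < 1 := by
    rw [div_lt_one (by positivity)]; exact_mod_cast j.2
  gcongr
  linarith

lemma prod_erase_abs_sub {q : ℕ} (j : Fin (q + 1)) :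
    ∏ i ∈ Finset.univ.erase j, |(j : ℝ) - (i : ℕ)| =
      ((j : ℕ).factorial * (q - j).factorial : ℕ) := by
  have h0 : ∏ i ∈ Finset.univ.erase j, |(j : ℝ) - (i : ℕ)| =
      ∏ i ∈ (Finset.range (q + 1)).erase j, |(j : ℝ) - (i : ℕ)| := by
    refine Finset.prod_nbij (fun i => (i : ℕ)) (fun i hi => ?_) (fun i _ i' _ h => Fin.ext h)
      (fun i hi => ?_) fun i _ => rfl
    · have := Finset.ne_of_mem_erase hi
      exact Finset.mem_erase.2 ⟨fun h => this (Fin.ext h), Finset.mem_range.2 i.2⟩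
    · have h1 := Finset.mem_erase.1 hi
      refine ⟨⟨i, Finset.mem_range.1 h1.2⟩, ?_, rfl⟩
      simpa [Fin.ext_iff] using h1.1
  have h1 : (Finset.range (q + 1)).erase j = Finset.range j ∪ Finset.Ico (j + 1 : ℕ) (q + 1) := by
    ext i
    have := j.2
    simp only [Finset.mem_erase, Finset.mem_range, Finset.mem_union, Finset.mem_Ico]
    omega
  rw [h0, h1, Finset.prod_union, Nat.cast_mul]
  · congr 1
    · rw [← Finset.prod_range_reflect, ← Finset.prod_range_add_one_eq_factorial, Nat.cast_prod]
      refine Finset.prod_congr rfl fun i hi => ?_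
      have hi := Finset.mem_range.1 hi
      rw [show (j : ℕ) - 1 - i = j - (i + 1) by omega, Nat.cast_sub (by omega)]
      rw [sub_sub_cancel, Nat.abs_cast]
    · rw [Finset.prod_Ico_eq_prod_range, ← Finset.prod_range_add_one_eq_factorial, Nat.cast_prod]
      refine Finset.prod_congr (by congr 1; omega) fun i hi => ?_
      rw [abs_sub_comm, ← Nat.abs_cast (i + 1)]
      congr 1
      push_cast
      ring
  · rw [Finset.disjoint_left]
    intro i hi hi'
    have := Finset.mem_range.1 hi
    have := Finset.mem_Ico.1 hi'
    omega

lemma succ_pow_le_three_pow_mul_factorial (q : ℕ) :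
    ((q : ℝ) + 1) ^ q ≤ 3 ^ q * q.factorial := by
  induction q with
  | zero => simp
  | succ q ih =>
    have h1 : (((q + 1 : ℕ) : ℝ) + 1) ^ (q + 1) ≤ 3 * ((q : ℝ) + 1) ^ (q + 1) := by
      have h2 : ((q + 1 : ℕ) : ℝ) + 1 = ((q : ℝ) + 1) * (1 / ((q : ℝ) + 1) + 1) := by
        push_cast; field_simp; ring
      rw [h2, mul_pow, mul_comm 3]
      refine mul_le_mul_of_nonneg_left ?_ (by positivity)
      calc _ ≤ (Real.exp (1 / ((q : ℝ) + 1))) ^ (q + 1) := by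
            gcongr; exact Real.add_one_le_exp _
        _ = Real.exp 1 := by
            rw [← Real.exp_nat_mul]; congr 1; push_cast; field_simp
        _ ≤ 3 := by have := Real.exp_one_lt_d9; linarith
    refine h1.trans ?_
    have : (0 : ℝ) ≤ (q : ℝ) + 1 := by positivity
    have h3 := mul_le_mul_of_nonneg_right ih this
    rw [Nat.factorial_succ, pow_succ, pow_succ (3 : ℝ)]
    push_cast
    linarith

lemma sum_abs_powerCoeff_blockNode_le {q n : ℕ} (hn : 1 ≤ n) (β : ℕ) {a : ℕ} (ha : a ≤ q) {y : ℝ}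
    (hy : ∀ i, |y - blockNode q n β i| ≤ (n : ℝ)⁻¹) :
    ∑ j, |powerCoeff (blockNode q n β) j a y| ≤
      (n : ℝ)⁻¹ ^ a / a.factorial * n ^ q * 6 ^ q := by
  have hn' : (0 : ℝ) < n := by exact_mod_cast hn
  have h1 (j : Fin (q + 1)) : |powerCoeff (blockNode q n β) j a y| ≤
      (n : ℝ)⁻¹ ^ a / a.factorial * n ^ q * (((q : ℝ) + 1) ^ q / q.factorial) * q.choose j := by
    refine (abs_powerCoeff_le (blockNode_injective hn β) j ha hy).trans (le_of_eq ?_)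
    have h2 : ∏ i ∈ Finset.univ.erase j, |blockNode q n β j - blockNode q n β i| =
        ((j : ℕ).factorial * (q - j).factorial : ℕ) / ((q + 1) * n) ^ q := by
      simp only [blockNode_sub, abs_div, Finset.prod_div_distrib, prod_erase_abs_sub]
      rw [Finset.prod_const, Finset.card_erase_of_mem (Finset.mem_univ _)]
      congr 2
      · exact abs_of_nonneg (by positivity)
      · simp
    have h3 : (q.choose j : ℝ) * (j : ℕ).factorial * (q - j).factorial = q.factorial := by
      exact_mod_cast Nat.choose_mul_factorial_mul_factorial (show (j : ℕ) ≤ q by omega)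
    rw [h2, ← h3]
    have h4 : (q.choose j : ℝ) ≠ 0 := by
      exact_mod_cast (Nat.choose_pos (show (j : ℕ) ≤ q by omega)).ne'
    push_cast
    field_simp
    rw [mul_pow]
  refine (Finset.sum_le_sum fun j _ => h1 j).trans ?_
  rw [← Finset.mul_sum]
  have h5 : ∑ j : Fin (q + 1), (q.choose j : ℝ) = 2 ^ q := by
    rw [← Finset.sum_range (f := fun j => (q.choose j : ℝ))]
    exact_mod_cast Nat.sum_range_choose q
  rw [h5, mul_assoc]
  refine mul_le_mul_of_nonneg_left ?_ (by positivity)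
  rw [show (6 : ℝ) = 3 * 2 by norm_num, mul_pow]
  gcongr
  rw [div_le_iff₀ (by positivity)]
  exact succ_pow_le_three_pow_mul_factorial q

/-- The part of a spline which is supported to the right of the nodes of the `β`-th block. -/
noncomputable def blockSpline (q n β a γ : ℕ) (y x : ℝ) : ℝ :=
  ∑ j, powerCoeff (blockNode q n β) j a y * truncPow q γ (blockNode q n β j) x

lemma blockSpline_eq_taylorTerm {q n β a γ : ℕ} (hn : 1 ≤ n) (ha : a ≤ q) (hγ : γ ≤ q) {x : ℝ}
    (hx : (β : ℝ) / n ≤ x) (y : ℝ) : blockSpline q n β a γ y x = taylorTerm a γ (x - y) := by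
  rw [← sum_powerCoeff_mul_pow (blockNode_injective hn β) ha hγ]
  refine Finset.sum_congr rfl fun j _ => ?_
  rw [truncPow, if_pos ((blockNode_lt hn j).le.trans hx)]

lemma blockSpline_eq_zero {q n β a γ : ℕ} {x : ℝ} (hx : x < ((β : ℝ) - 1) / n) (y : ℝ) :
    blockSpline q n β a γ y x = 0 := by
  refine Finset.sum_eq_zero fun j _ => ?_
  rw [truncPow, if_neg (not_le.2 (hx.trans_le (le_blockNode j))), mul_zero]

lemma abs_sub_blockNode_le {q n β : ℕ} (hn : 1 ≤ n) {x : ℝ} (h1 : ((β : ℝ) - 1) / n ≤ x)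
    (h2 : x ≤ β / n) (j : Fin (q + 1)) : |x - blockNode q n β j| ≤ (n : ℝ)⁻¹ := by
  have h3 := le_blockNode (n := n) (β := β) j
  have h4 := blockNode_lt (β := β) hn j
  rw [sub_div, one_div] at h1 h3
  rw [abs_le]
  constructor <;> linarith

lemma abs_truncPow_le {q γ : ℕ} {t x ρ : ℝ} (hρ : |x - t| ≤ ρ) :
    |truncPow q γ t x| ≤ q ^ γ * ρ ^ (q - γ) := by
  have hρ0 := (abs_nonneg _).trans hρ
  unfold truncPow
  split_ifs with h
  · rw [abs_mul, abs_pow, Nat.abs_cast]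
    gcongr
    exact_mod_cast Nat.descFactorial_le_pow q γ
  · rw [abs_zero]; positivity

lemma abs_blockSpline_le {q n β a γ : ℕ} (hn : 1 ≤ n) (ha : a ≤ q) (hγ : γ ≤ q) {y x : ℝ}
    (hy1 : ((β : ℝ) - 1) / n ≤ y) (hy2 : y ≤ β / n)
    (hx1 : ((β : ℝ) - 1) / n ≤ x) (hx2 : x ≤ β / n) :
    (n : ℝ)⁻¹ ^ γ * |blockSpline q n β a γ y x| ≤
      (n : ℝ)⁻¹ ^ a / a.factorial * q ^ γ * 6 ^ q := by
  have hn' : (0 : ℝ) < n := by exact_mod_cast hn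
  have h1 : |blockSpline q n β a γ y x| ≤
      (n : ℝ)⁻¹ ^ a / a.factorial * n ^ q * 6 ^ q * (q ^ γ * (n : ℝ)⁻¹ ^ (q - γ)) := by
    refine (Finset.abs_sum_le_sum_abs _ _).trans ?_
    refine le_trans ?_ (mul_le_mul_of_nonneg_right (sum_abs_powerCoeff_blockNode_le hn β ha
      fun i => abs_sub_blockNode_le hn hy1 hy2 i) (by positivity))
    rw [Finset.sum_mul]
    refine Finset.sum_le_sum fun j _ => ?_
    rw [abs_mul]
    exact mul_le_mul_of_nonneg_left (abs_truncPow_le (abs_sub_blockNode_le hn hx1 hx2 j))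
      (abs_nonneg _)
  refine (mul_le_mul_of_nonneg_left h1 (by positivity)).trans (le_of_eq ?_)
  have h2 : (n : ℝ)⁻¹ ^ γ * (n : ℝ)⁻¹ ^ (q - γ) * n ^ q = 1 := by
    rw [← pow_add, Nat.add_sub_cancel' hγ, ← mul_pow, inv_mul_cancel₀ hn'.ne', one_pow]
  linear_combination ((n : ℝ)⁻¹ ^ a / a.factorial * q ^ γ * 6 ^ q) * h2

lemma abs_taylorTerm_le {q a γ : ℕ} (ha : a ≤ q) {u ρ : ℝ} (hu : |u| ≤ ρ) :
    ρ ^ γ * |taylorTerm a γ u| ≤ ρ ^ a / a.factorial * q ^ γ := by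
  have hρ0 := (abs_nonneg _).trans hu
  unfold taylorTerm
  split_ifs with h
  · rw [abs_div, abs_pow, Nat.abs_cast]
    have h1 : (a.factorial : ℝ) ≤ (a - γ).factorial * q ^ γ := by
      rw [← Nat.factorial_mul_descFactorial h]
      push_cast
      gcongr
      exact_mod_cast (Nat.descFactorial_le_pow a γ).trans (Nat.pow_le_pow_left ha γ)
    have h2 : ρ ^ γ * ρ ^ (a - γ) = ρ ^ a := by rw [← pow_add, Nat.add_sub_cancel' h]
    rw [mul_div_assoc', div_mul_eq_mul_div, div_le_div_iff₀ (by positivity) (by positivity)]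
    calc ρ ^ γ * |u| ^ (a - γ) * a.factorial
        ≤ ρ ^ γ * ρ ^ (a - γ) * ((a - γ).factorial * q ^ γ) := by gcongr
      _ = _ := by rw [h2]; ring
  · rw [abs_zero, mul_zero]; positivity

lemma sum_taylorTerm_mul_blockSpline {q n β δ γ : ℕ} (hn : 1 ≤ n) (hδ : δ ≤ q) (y z x : ℝ) :
    ∑ a ∈ Finset.range (q + 1), taylorTerm δ a (y - z) * blockSpline q n β a γ y x =
      blockSpline q n β δ γ z x := by
  simp only [blockSpline, Finset.mul_sum]
  rw [Finset.sum_comm]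
  refine Finset.sum_congr rfl fun j _ => ?_
  rw [← sum_taylorTerm_mul_powerCoeff (blockNode_injective hn β) j hδ z y, Finset.sum_mul]
  exact Finset.sum_congr rfl fun a _ => by ring

/-- The coefficients of the spline basis functions with respect to truncated powers. -/
noncomputable def splineCoeff (q n β a : ℕ) (P : Fin n × Fin (q + 1)) : ℝ :=
  if (P.1 : ℕ) = β then powerCoeff (blockNode q n P.1) P.2 a (β / n)
  else if (P.1 : ℕ) = β + 1 then -powerCoeff (blockNode q n P.1) P.2 a (β / n)
  else 0

/-- The `γ`-th derivative of the spline basis function of index `a` located at `β / n`. -/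
noncomputable def splineBasis (q n β a γ : ℕ) (x : ℝ) : ℝ :=
  ∑ P, splineCoeff q n β a P * truncPow q γ (blockNode q n P.1 P.2) x

lemma splineBasis_eq {q n β a γ : ℕ} (hβ : β < n) (x : ℝ) :
    splineBasis q n β a γ x = blockSpline q n β a γ (β / n) x -
      if β + 1 < n then blockSpline q n (β + 1) a γ (β / n) x else 0 := by
  have h (b : Fin n) : ∑ j, splineCoeff q n β a (b, j) * truncPow q γ (blockNode q n b j) x =
      (if β = b then blockSpline q n b a γ (β / n) x else 0) -
        if β + 1 = b then blockSpline q n b a γ (β / n) x else 0 := by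
    by_cases h1 : (b : ℕ) = β
    · rw [if_pos h1.symm, if_neg (by omega), sub_zero]
      simp [splineCoeff, h1, blockSpline]
    · by_cases h2 : (b : ℕ) = β + 1
      · rw [if_neg (by omega), if_pos h2.symm, zero_sub]
        simp [splineCoeff, h2, blockSpline]
      · rw [if_neg (by omega), if_neg (by omega), sub_zero]
        simp [splineCoeff, h1, h2]
  rw [splineBasis, Fintype.sum_prod_type]
  simp only [h]
  rw [← Finset.sum_range (f := fun b => (if β = b then blockSpline q n b a γ (β / n) x else 0) -
        if β + 1 = b then blockSpline q n b a γ (β / n) x else 0), Finset.sum_sub_distrib,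
    Finset.sum_ite_eq, Finset.sum_ite_eq]
  simp [hβ]

lemma sum_taylorTerm_mul_splineBasis {q n δ γ : ℕ} (hn : 1 ≤ n) (hδ : δ ≤ q) (hγ : γ ≤ q) {x : ℝ}
    (hx : 0 ≤ x) :
    ∑ a ∈ Finset.range (q + 1), ∑ β ∈ Finset.range n,
      taylorTerm δ a (β / n - x) * splineBasis q n β a γ x = if δ = γ then 1 else 0 := by
  have h0 : blockSpline q n 0 δ γ x x = if δ = γ then 1 else 0 := by
    rw [blockSpline_eq_taylorTerm hn hδ hγ (by simpa using hx), sub_self, taylorTerm]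
    split_ifs with h1 h2 h2
    · simp [h2]
    · rw [zero_pow (by omega), zero_div]
    · omega
    · rfl
  rw [Finset.sum_comm, ← h0]
  have h1 : ∀ β ∈ Finset.range n, ∑ a ∈ Finset.range (q + 1),
      taylorTerm δ a (β / n - x) * splineBasis q n β a γ x =
        (if β < n then blockSpline q n β δ γ x x else 0) -
          if β + 1 < n then blockSpline q n (β + 1) δ γ x x else 0 := by
    intro β hβ
    have hβ := Finset.mem_range.1 hβ
    simp only [splineBasis_eq hβ, mul_sub, Finset.sum_sub_distrib,
      sum_taylorTerm_mul_blockSpline hn hδ]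
    rw [if_pos hβ]
    congr 1
    split_ifs with h
    · exact sum_taylorTerm_mul_blockSpline hn hδ _ _ _
    · simp
  rw [Finset.sum_congr rfl h1,
    Finset.sum_range_sub' (fun β => if β < n then blockSpline q n β δ γ x x else 0)]
  simp [show 0 < n from hn]

lemma exists_splineBasis_bound {q n : ℕ} (hn : 1 ≤ n) {x : ℝ} (hx : x ∈ Set.Icc (0 : ℝ) 1)
    {γ : ℕ} (hγ : γ ≤ q) :
    (∀ a ≤ q, ∀ β < n, splineBasis q n β a γ x ≠ 0 → |(β : ℝ) / n - x| ≤ (n : ℝ)⁻¹) ∧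
      ∀ a ≤ q, (n : ℝ)⁻¹ ^ γ * ∑ β ∈ Finset.range n, |splineBasis q n β a γ x| ≤
        (n : ℝ)⁻¹ ^ a / a.factorial * q ^ γ * (3 * 6 ^ q) := by
  have hn' : (0 : ℝ) < n := by exact_mod_cast hn
  obtain ⟨m, hmn, hm1, hm2, hm3⟩ : ∃ m < n, (m : ℝ) / n ≤ x ∧ x ≤ ((m : ℝ) + 1) / n ∧
      (m + 1 < n → x < ((m : ℝ) + 1) / n) := by
    have hf := Nat.floor_le (mul_nonneg hx.1 hn'.le)
    have hf' := Nat.lt_floor_add_one (x * n)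
    by_cases h : ⌊x * n⌋₊ < n
    · refine ⟨_, h, ?_, ?_, fun _ => ?_⟩
      · rwa [div_le_iff₀ hn']
      · rw [le_div_iff₀ hn']; exact hf'.le
      · rwa [lt_div_iff₀ hn']
    · refine ⟨n - 1, by omega, ?_, ?_, fun h => by omega⟩
      · rw [div_le_iff₀ hn']
        refine le_trans ?_ hf
        exact_mod_cast (by omega : n - 1 ≤ ⌊x * n⌋₊)
      · rw [Nat.cast_sub hn, Nat.cast_one, sub_add_cancel, div_self hn'.ne']
        exact hx.2
  have hmul {b c : ℕ} (h : b ≤ c) : (b : ℝ) / n ≤ c / n := by gcongr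
  have hlow : ∀ a ≤ q, ∀ β < m, splineBasis q n β a γ x = 0 := by
    intro a ha β hβ
    rw [splineBasis_eq (hβ.trans hmn), if_pos (by omega),
      blockSpline_eq_taylorTerm hn ha hγ ((hmul hβ.le).trans hm1),
      blockSpline_eq_taylorTerm hn ha hγ ((hmul hβ).trans hm1), sub_self]
  have hzero : ∀ a β : ℕ, m + 2 ≤ β → β < n → ∀ y, blockSpline q n β a γ y x = 0 := by
    intro a β hβ hβn y
    refine blockSpline_eq_zero ((hm3 (by omega)).trans_le ?_) y
    have : (m : ℝ) + 2 ≤ β := by exact_mod_cast hβ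
    gcongr
    linarith
  have hhigh : ∀ a β : ℕ, m + 2 ≤ β → β < n → splineBasis q n β a γ x = 0 := by
    intro a β hβ hβn
    rw [splineBasis_eq hβn, hzero a β hβ hβn]
    split_ifs with h
    · rw [hzero a (β + 1) (by omega) h, sub_zero]
    · rw [sub_zero]
  have hm2' : x ≤ m / n + (n : ℝ)⁻¹ := by rwa [add_div, one_div] at hm2
  constructor
  · intro a ha β hβ hne
    have h1 : m ≤ β := by
      by_contra h; exact hne (hlow a ha β (by omega))
    have h2 : β < m + 2 := by
      by_contra h; exact hne (hhigh a β (by omega) hβ)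
    obtain rfl | rfl : β = m ∨ β = m + 1 := by omega
    · rw [abs_le]; constructor <;> linarith [inv_pos.2 hn']
    · rw [Nat.cast_add, Nat.cast_one, add_div, one_div, abs_le]
      constructor <;> linarith
  · intro a ha
    set B := (n : ℝ)⁻¹ ^ a / a.factorial * q ^ γ with hB
    have hB0 : 0 ≤ B := by positivity
    have hpart : ∀ y, (m : ℝ) / n ≤ y → y ≤ ((m : ℝ) + 1) / n →
        (n : ℝ)⁻¹ ^ γ * |blockSpline q n (m + 1) a γ y x| ≤ B * 6 ^ q := by
      intro y hy1 hy2
      refine abs_blockSpline_le hn ha hγ ?_ ?_ ?_ ?_ <;> push_cast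
      · rwa [add_sub_cancel_right]
      · exact hy2
      · rwa [add_sub_cancel_right]
      · exact hm2
    have hsplit : ∑ β ∈ Finset.range n, |splineBasis q n β a γ x| =
        |splineBasis q n m a γ x| + if m + 1 < n then |splineBasis q n (m + 1) a γ x| else 0 := by
      have h1 : ∀ β ∈ Finset.range n, |splineBasis q n β a γ x| =
          (if m = β then |splineBasis q n β a γ x| else 0) +
            if m + 1 = β then |splineBasis q n β a γ x| else 0 := by
        intro β hβ
        have hβ := Finset.mem_range.1 hβ
        by_cases h1 : m = β
        · simp [h1]
        · by_cases h2 : m + 1 = β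
          · rw [if_neg h1, if_pos h2, zero_add]
          · rw [if_neg h1, if_neg h2, add_zero]
            rcases lt_or_gt_of_ne h1 with h | h
            · rw [hhigh a β (by omega) hβ, abs_zero]
            · rw [hlow a ha β h, abs_zero]
      rw [Finset.sum_congr rfl h1, Finset.sum_add_distrib, Finset.sum_ite_eq, Finset.sum_ite_eq]
      simp [hmn]
    have hfirst : (n : ℝ)⁻¹ ^ γ * |splineBasis q n m a γ x| ≤ B + B * 6 ^ q := by
      have ht : (n : ℝ)⁻¹ ^ γ * |blockSpline q n m a γ (m / n) x| ≤ B := by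
        rw [blockSpline_eq_taylorTerm hn ha hγ hm1]
        refine abs_taylorTerm_le ha ?_
        rw [abs_le]; constructor <;> linarith [inv_pos.2 hn']
      rw [splineBasis_eq hmn]
      split_ifs with h
      · have := hpart (m / n) le_rfl (hm1.trans hm2)
        calc _ ≤ (n : ℝ)⁻¹ ^ γ * (|blockSpline q n m a γ (m / n) x| +
              |blockSpline q n (m + 1) a γ (m / n) x|) := by gcongr; exact abs_sub _ _
          _ ≤ _ := by rw [mul_add]; linarith
      · rw [sub_zero]
        have : 0 ≤ B * 6 ^ q := by positivity
        linarith
    have hsecond : (n : ℝ)⁻¹ ^ γ * (if m + 1 < n then |splineBasis q n (m + 1) a γ x| else 0) ≤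
        B * 6 ^ q := by
      split_ifs with h
      · rw [splineBasis_eq h]
        have h2 : (if m + 1 + 1 < n then
            blockSpline q n (m + 1 + 1) a γ ((m + 1 : ℕ) / n) x else 0) = 0 := by
          split_ifs with h'
          · exact hzero a _ (by omega) h' _
          · rfl
        rw [h2, sub_zero]
        refine hpart _ ?_ ?_
        · exact hmul (Nat.le_succ m)
        · push_cast; exact le_rfl
      · rw [mul_zero]; positivity
    have h6 : (1 : ℝ) ≤ 6 ^ q := one_le_pow₀ (by norm_num)
    rw [hsplit, mul_add]
    nlinarith [mul_le_mul_of_nonneg_left h6 hB0]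

lemma sum_abs_splineCoeff_le {q n : ℕ} (hn : 1 ≤ n) (P : Fin n × Fin (q + 1)) :
    ∑ a ∈ Finset.range (q + 1), ∑ β ∈ Finset.range n, |splineCoeff q n β a P| ≤
      6 ^ (q + 1) * n ^ q := by
  have hn' : (1 : ℝ) ≤ n := by exact_mod_cast hn
  have hcoef : ∀ a ≤ q, ∀ y, (((P.1 : ℕ) : ℝ) - 1) / n ≤ y → y ≤ ((P.1 : ℕ) : ℝ) / n →
      |powerCoeff (blockNode q n P.1) P.2 a y| ≤ 1 / a.factorial * (n ^ q * 6 ^ q) := by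
    intro a ha y h1 h2
    refine (Finset.single_le_sum
      (f := fun j => |powerCoeff (blockNode q n P.1) j a y|) (fun _ _ => abs_nonneg _)
      (Finset.mem_univ P.2)).trans ((sum_abs_powerCoeff_blockNode_le hn P.1 ha
        fun i => abs_sub_blockNode_le hn h1 h2 i).trans ?_)
    rw [mul_assoc]
    have : (n : ℝ)⁻¹ ^ a ≤ 1 := pow_le_one₀ (by positivity) (inv_le_one_of_one_le₀ hn')
    gcongr
  have hsum : ∀ a ∈ Finset.range (q + 1), ∑ β ∈ Finset.range n, |splineCoeff q n β a P| ≤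
      1 / a.factorial * (2 * (n ^ q * 6 ^ q)) := by
    intro a ha
    have ha : a ≤ q := by have := Finset.mem_range.1 ha; omega
    have h1 : ∀ β ∈ Finset.range n, |splineCoeff q n β a P| ≤
        (if (P.1 : ℕ) = β then 1 / a.factorial * ((n : ℝ) ^ q * 6 ^ q) else 0) +
          if (P.1 : ℕ) - 1 = β then 1 / a.factorial * ((n : ℝ) ^ q * 6 ^ q) else 0 := by
      intro β _
      have hpos : (0 : ℝ) ≤ 1 / a.factorial * ((n : ℝ) ^ q * 6 ^ q) := by positivity
      unfold splineCoeff
      split_ifs with h1 h2 h3 h4 h5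
      any_goals omega
      any_goals (rw [abs_zero])
      any_goals positivity
      · refine (hcoef a ha _ ?_ ?_).trans (by linarith) <;> rw [h1]
        gcongr; linarith
      · refine (hcoef a ha _ ?_ ?_).trans (by linarith) <;> rw [h1]
        gcongr; linarith
      · rw [abs_neg, zero_add]
        refine hcoef a ha _ ?_ ?_ <;> rw [h3] <;> push_cast
        · rw [add_sub_cancel_right]
        · gcongr; linarith
    refine (Finset.sum_le_sum h1).trans ?_
    rw [Finset.sum_add_distrib, Finset.sum_ite_eq, Finset.sum_ite_eq,
      if_pos (Finset.mem_range.2 P.1.2), if_pos (Finset.mem_range.2 (by omega))]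
    linarith
  refine (Finset.sum_le_sum hsum).trans ?_
  rw [← Finset.sum_mul]
  have he : ∑ a ∈ Finset.range (q + 1), (1 : ℝ) / a.factorial ≤ 3 := by
    have h := Real.sum_le_exp_of_nonneg zero_le_one (q + 1)
    simp only [one_pow] at h
    linarith [Real.exp_one_lt_d9]
  calc _ ≤ 3 * (2 * ((n : ℝ) ^ q * 6 ^ q)) := by gcongr
    _ = _ := by ring

lemma hasDerivWithinAt_truncPow (q m : ℕ) (t x : ℝ) :
    HasDerivWithinAt (truncPow q m t) (truncPow q (m + 1) t x) (Set.Ici x) x := by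
  have hpow : HasDerivAt (fun y : ℝ => q.descFactorial m * (y - t) ^ (q - m))
      (q.descFactorial (m + 1) * (x - t) ^ (q - (m + 1))) x := by
    have h := (((hasDerivAt_id x).sub_const t).pow (q - m)).const_mul (q.descFactorial m : ℝ)
    refine h.congr_deriv ?_
    rw [Nat.descFactorial_succ, Nat.sub_sub, mul_one]
    push_cast
    simp only [id]
    ring
  by_cases h : t ≤ x
  · have h1 : ∀ y ∈ Set.Ici x, truncPow q m t y = q.descFactorial m * (y - t) ^ (q - m) :=
      fun y hy => if_pos (h.trans hy)
    rw [truncPow, if_pos h]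
    exact hpow.hasDerivWithinAt.congr h1 (h1 x Set.self_mem_Ici)
  · rw [truncPow, if_neg h]
    refine HasDerivAt.hasDerivWithinAt ((hasDerivAt_const x (0 : ℝ)).congr_of_eventuallyEq ?_)
    filter_upwards [gt_mem_nhds (not_le.1 h)] with y hy
    exact if_neg (not_le.2 hy)

lemma truncPow_eq_max {q m : ℕ} (hm : m < q) (t x : ℝ) :
    truncPow q m t x = q.descFactorial m * max (x - t) 0 ^ (q - m) := by
  unfold truncPow
  split_ifs with h
  · rw [max_eq_left (by linarith)]
  · rw [max_eq_right (by linarith), zero_pow (by omega), mul_zero]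

lemma continuous_truncPow {q m : ℕ} (hm : m < q) (t : ℝ) : Continuous (truncPow q m t) := by
  rw [funext (truncPow_eq_max hm t)]
  fun_prop

lemma hasDerivAt_truncPow {q m : ℕ} (hm : m + 2 ≤ q) (t x : ℝ) :
    HasDerivAt (truncPow q m t) (truncPow q (m + 1) t x) x := by
  have hleft : HasDerivWithinAt (truncPow q m t) (truncPow q (m + 1) t x) (Set.Iic x) x := by
    by_cases h : x ≤ t
    · have h1 : ∀ y ∈ Set.Iic x, truncPow q m t y = 0 := fun y hy => by
        rw [truncPow_eq_max (by omega), max_eq_right (by linarith [Set.mem_Iic.1 hy]),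
          zero_pow (by omega), mul_zero]
      rw [truncPow_eq_max (by omega), max_eq_right (by linarith), zero_pow (by omega), mul_zero]
      exact (hasDerivWithinAt_const x _ (0 : ℝ)).congr h1 (h1 x Set.self_mem_Iic)
    · have hlt := not_le.1 h
      have h2 := hasDerivWithinAt_truncPow q m t x
      have hpow : HasDerivAt (fun y : ℝ => q.descFactorial m * (y - t) ^ (q - m))
          (truncPow q (m + 1) t x) x := by
        have h3 : DifferentiableAt ℝ
            (fun y : ℝ => q.descFactorial m * (y - t) ^ (q - m)) x := by fun_prop
        have h4 := h3.hasDerivAt.hasDerivWithinAt (s := Set.Ici x)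
        have h5 : ∀ y ∈ Set.Ici x, truncPow q m t y = q.descFactorial m * (y - t) ^ (q - m) :=
          fun y hy => if_pos (hlt.le.trans hy)
        have h6 := h4.congr h5 (h5 x Set.self_mem_Ici)
        rw [(uniqueDiffOn_Ici x x Set.self_mem_Ici).eq_deriv _ h2 h6]
        exact h3.hasDerivAt
      refine (hpow.congr_of_eventuallyEq ?_).hasDerivWithinAt
      filter_upwards [lt_mem_nhds hlt] with y hy
      exact if_pos hy.le
  have h := hleft.union (hasDerivWithinAt_truncPow q m t x)
  rwa [Set.Iic_union_Ici, hasDerivWithinAt_univ] at h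

lemma hasDerivAt_taylorTerm (a γ : ℕ) (u : ℝ) :
    HasDerivAt (taylorTerm a γ) (taylorTerm a (γ + 1) u) u := by
  by_cases h : γ ≤ a
  · have h1 : taylorTerm a γ = fun u : ℝ => u ^ (a - γ) / (a - γ).factorial :=
      funext fun u => if_pos h
    rw [h1]
    refine ((hasDerivAt_pow (a - γ) u).div_const _).congr_deriv ?_
    unfold taylorTerm
    split_ifs with h2
    · obtain ⟨c, rfl⟩ := Nat.exists_eq_add_of_le h2
      rw [show γ + 1 + c - γ = c + 1 by omega, show γ + 1 + c - (γ + 1) = c by omega,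
        Nat.factorial_succ]
      push_cast
      field_simp
    · rw [show a - γ = 0 by omega]; simp
  · have h1 : taylorTerm a γ = fun _ => 0 := funext fun u => if_neg h
    rw [h1, taylorTerm, if_neg (by omega)]
    exact hasDerivAt_const u 0

section Jets

variable {d : ℕ}

/-- `G κ` is the partial derivative of order `κ` of `G 0`, for all `κ` up to order `m`. -/
def IsJet (m : ℕ) (G : (Fin d → ℕ) → (Fin d → ℝ) → ℝ) : Prop :=
  ∀ κ, ∑ i, κ i < m → ∀ x, HasFDerivAt (G κ)
    (∑ i, G (κ + Pi.single i 1) x • ContinuousLinearMap.proj (R := ℝ) (φ := fun _ => ℝ) i) x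

lemma IsJet.sub {m : ℕ} {G G' : (Fin d → ℕ) → (Fin d → ℝ) → ℝ} (h : IsJet m G)
    (h' : IsJet m G') : IsJet m fun κ x => G κ x - G' κ x := by
  intro κ hκ x
  refine ((h κ hκ x).sub (h' κ hκ x)).congr_fderiv ?_
  rw [← Finset.sum_sub_distrib]
  exact Finset.sum_congr rfl fun i _ => (sub_smul _ _ _).symm

lemma IsJet.sum {m : ℕ} {ι : Type*} {S : Finset ι} (c : ι → ℝ)
    {G : ι → (Fin d → ℕ) → (Fin d → ℝ) → ℝ} (h : ∀ j ∈ S, IsJet m (G j)) :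
    IsJet m fun κ x => ∑ j ∈ S, c j * G j κ x := by
  intro κ hκ x
  refine (HasFDerivAt.fun_sum fun j hj => (h j hj κ hκ x).const_mul (c j)).congr_fderiv ?_
  simp only [Finset.sum_smul, Finset.smul_sum, smul_smul]
  exact Finset.sum_comm

lemma IsJet.prod {m : ℕ} {g : Fin d → ℕ → ℝ → ℝ}
    (h : ∀ k, ∀ a < m, ∀ t, HasDerivAt (g k a) (g k (a + 1) t) t) :
    IsJet m fun κ x => ∏ k, g k (κ k) (x k) := by
  intro κ hκ x
  have hk (k : Fin d) : κ k < m :=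
    (Finset.single_le_sum (fun _ _ => Nat.zero_le _) (Finset.mem_univ k)).trans_lt hκ
  have h1 (k : Fin d) : HasFDerivAt (fun y : Fin d → ℝ => g k (κ k) (y k))
      (g k (κ k + 1) (x k) • ContinuousLinearMap.proj (R := ℝ) (φ := fun _ => ℝ) k) x :=
    (h k (κ k) (hk k) (x k)).comp_hasFDerivAt x
      (ContinuousLinearMap.proj (R := ℝ) (φ := fun _ => ℝ) k).hasFDerivAt
  refine (HasFDerivAt.finsetProd fun k _ => h1 k).congr_fderiv ?_
  refine Finset.sum_congr rfl fun i _ => ?_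
  rw [smul_smul]
  congr 1
  show _ = ∏ k, g k ((κ + Pi.single i 1 : Fin d → ℕ) k) (x k)
  rw [← Finset.mul_prod_erase _ _ (Finset.mem_univ i), mul_comm]
  congr 1
  · simp
  · refine Finset.prod_congr rfl fun k hk => ?_
    simp [Finset.ne_of_mem_erase hk]

lemma IsJet.pderiv1_eq {m : ℕ} {G : (Fin d → ℕ) → (Fin d → ℝ) → ℝ} (h : IsJet m G)
    {κ : Fin d → ℕ} (hκ : ∑ i, κ i < m) (i : Fin d) :
    pderiv1 i (G κ) = G (κ + Pi.single i 1) := by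
  funext x
  rw [pderiv1, (h κ hκ x).fderiv]
  simp [Pi.single_apply]

lemma IsJet.mderiv_eq {m : ℕ} {G : (Fin d → ℕ) → (Fin d → ℝ) → ℝ} (h : IsJet m G)
    {γ : Fin d → ℕ} (hγ : ∑ i, γ i ≤ m) : mderiv γ (G 0) = G γ := by
  have hiter (i : Fin d) (κ : Fin d → ℕ) (c : ℕ) (hc : ∑ i, κ i + c ≤ m) :
      (pderiv1 i)^[c] (G κ) = G (κ + Pi.single i c) := by
    induction c with
    | zero => simp
    | succ c ih =>
      rw [Function.iterate_succ_apply', ih (by omega), h.pderiv1_eq, add_assoc, ← Pi.single_add]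
      simp only [Pi.add_apply, Finset.sum_add_distrib, Finset.sum_pi_single', Finset.mem_univ,
        if_true]
      omega
  have hlist (L : List (Fin d)) (hL : L.Nodup) :
      L.foldr (fun i h => (pderiv1 i)^[γ i] h) (G 0) = G fun i => if i ∈ L then γ i else 0 := by
    induction L with
    | nil => simp; rfl
    | cons j L ih =>
      have hj := (List.nodup_cons.1 hL).1
      have he : (fun i => if i ∈ L then γ i else 0) + Pi.single j (γ j) =
          fun i => if i ∈ j :: L then γ i else 0 := by
        funext i
        by_cases hi : i = j
        · subst hi; simp [hj]
        · simp [hi]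
      rw [List.foldr_cons, ih (List.nodup_cons.1 hL).2, hiter, he]
      have h2 := congrArg (fun κ => ∑ i, κ i) he
      simp only [Pi.add_apply, Finset.sum_add_distrib, Finset.sum_pi_single', Finset.mem_univ,
        if_true] at h2
      rw [h2]
      refine le_trans (Finset.sum_le_sum fun i _ => ?_) hγ
      split_ifs <;> omega
  rw [mderiv, hlist _ (List.nodup_finRange d)]
  simp

lemma contDiff_pderiv1 {g : (Fin d → ℝ) → ℝ} (hg : ContDiff ℝ (⊤ : ℕ∞) g) (i : Fin d) :
    ContDiff ℝ (⊤ : ℕ∞) (pderiv1 i g) :=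
  (hg.fderiv_right (m := (⊤ : ℕ∞)) (by simp)).clm_apply contDiff_const

lemma pderiv1_comm {g : (Fin d → ℝ) → ℝ} (hg : ContDiff ℝ (⊤ : ℕ∞) g) (i j : Fin d) :
    pderiv1 i (pderiv1 j g) = pderiv1 j (pderiv1 i g) := by
  funext x
  have hd : DifferentiableAt ℝ (fderiv ℝ g) x :=
    (hg.fderiv_right (m := (⊤ : ℕ∞)) (by simp)).differentiable (by simp) x
  have h (a b : Fin d) : pderiv1 a (pderiv1 b g) x =
      fderiv ℝ (fderiv ℝ g) x (Pi.single a 1) (Pi.single b 1) := by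
    unfold pderiv1
    rw [fderiv_clm_apply hd (by fun_prop)]
    simp
  rw [h, h]
  exact (hg.contDiffAt.isSymmSndFDerivAt (by simpa using ENat.LEInfty.out)) _ _

lemma contDiff_iterate_pderiv1 {g : (Fin d → ℝ) → ℝ} (hg : ContDiff ℝ (⊤ : ℕ∞) g) (i : Fin d)
    (c : ℕ) : ContDiff ℝ (⊤ : ℕ∞) ((pderiv1 i)^[c] g) := by
  induction c with
  | zero => exact hg
  | succ c ih => rw [Function.iterate_succ_apply']; exact contDiff_pderiv1 ih i

lemma pderiv1_iterate_comm {g : (Fin d → ℝ) → ℝ} (hg : ContDiff ℝ (⊤ : ℕ∞) g) (i j : Fin d)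
    (c : ℕ) : pderiv1 i ((pderiv1 j)^[c] g) = (pderiv1 j)^[c] (pderiv1 i g) := by
  induction c with
  | zero => rfl
  | succ c ih =>
    rw [Function.iterate_succ_apply', Function.iterate_succ_apply',
      pderiv1_comm (contDiff_iterate_pderiv1 hg j c), ih]

lemma contDiff_foldr_pderiv1 {g : (Fin d → ℝ) → ℝ} (hg : ContDiff ℝ (⊤ : ℕ∞) g)
    (γ : Fin d → ℕ) (L : List (Fin d)) :
    ContDiff ℝ (⊤ : ℕ∞) (L.foldr (fun i h => (pderiv1 i)^[γ i] h) g) := by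
  induction L with
  | nil => exact hg
  | cons j L ih => exact contDiff_iterate_pderiv1 ih j _

lemma pderiv1_mderiv {g : (Fin d → ℝ) → ℝ} (hg : ContDiff ℝ (⊤ : ℕ∞) g) (i : Fin d)
    (γ : Fin d → ℕ) : pderiv1 i (mderiv γ g) = mderiv (γ + Pi.single i 1) g := by
  have hlist (L : List (Fin d)) (hL : L.Nodup) (hi : i ∈ L) :
      pderiv1 i (L.foldr (fun j h => (pderiv1 j)^[γ j] h) g) =
        L.foldr (fun j h => (pderiv1 j)^[(γ + Pi.single i 1 : Fin d → ℕ) j] h) g := by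
    induction L with
    | nil => simp at hi
    | cons j L ih =>
      have hj := List.nodup_cons.1 hL
      rw [List.foldr_cons, List.foldr_cons]
      by_cases hij : i = j
      · subst hij
        rw [← Function.iterate_succ_apply' (pderiv1 i)]
        congr 1
        · simp
        · refine List.foldr_ext _ _ _ fun k hk h => ?_
          rw [Pi.add_apply, Pi.single_eq_of_ne (fun h' : k = i => hj.1 (h' ▸ hk)), add_zero]
      · rw [pderiv1_iterate_comm (contDiff_foldr_pderiv1 hg γ L),
          ih hj.2 ((List.mem_cons.1 hi).resolve_left hij), Pi.add_apply,
          Pi.single_eq_of_ne (Ne.symm hij), add_zero]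
  exact hlist _ (List.nodup_finRange d) (List.mem_finRange i)

lemma isJet_mderiv {g : (Fin d → ℝ) → ℝ} (hg : ContDiff ℝ (⊤ : ℕ∞) g) (m : ℕ) :
    IsJet m fun κ => mderiv κ g := by
  intro κ _ x
  have h := ((contDiff_foldr_pderiv1 hg κ (List.finRange d)).differentiable
    (by simp) x).hasFDerivAt
  refine h.congr_fderiv (ContinuousLinearMap.ext fun v => ?_)
  rw [sum_apply]
  conv_lhs => rw [← Finset.univ_sum_single v, map_sum]
  refine Finset.sum_congr rfl fun i _ => ?_
  have h2 : (Pi.single i (v i) : Fin d → ℝ) = v i • Pi.single i 1 := by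
    rw [← Pi.single_smul, smul_eq_mul, mul_one]
  have h3 := congrFun (pderiv1_mderiv hg i κ) x
  rw [h2, map_smul, smul_eq_mul, mul_comm]
  exact congrArg (· * v i) h3

end Jets

section Taylor

variable {d : ℕ}

/-- The multi-indices of order at most `q`. -/
def lowIndices (d q : ℕ) : Finset (Fin d → ℕ) :=
  (Fintype.piFinset fun _ => Finset.range (q + 1)).filter fun α => ∑ k, α k ≤ q

lemma mem_lowIndices {q : ℕ} {α : Fin d → ℕ} : α ∈ lowIndices d q ↔ ∑ k, α k ≤ q := by
  refine ⟨fun h => (Finset.mem_filter.1 h).2, fun h => Finset.mem_filter.2 ⟨?_, h⟩⟩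
  refine Fintype.mem_piFinset.2 fun k => Finset.mem_range.2 (Nat.lt_succ_of_le (le_trans ?_ h))
  exact Finset.single_le_sum (fun _ _ => Nat.zero_le _) (Finset.mem_univ k)

lemma prod_taylorTerm_zero (δ α : Fin d → ℕ) :
    ∏ k, taylorTerm (δ k) (α k) 0 = if δ = α then 1 else 0 := by
  split_ifs with h
  · subst h; simp [taylorTerm]
  · obtain ⟨k, hk⟩ := Function.ne_iff.1 h
    refine Finset.prod_eq_zero (Finset.mem_univ k) ?_
    unfold taylorTerm
    split_ifs with h
    · rw [zero_pow (by omega), zero_div]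
    · rfl

lemma prod_taylorTerm_of_sum_le {δ α : Fin d → ℕ} (h : ∑ k, δ k ≤ ∑ k, α k) (u : Fin d → ℝ) :
    ∏ k, taylorTerm (δ k) (α k) (u k) = if δ = α then 1 else 0 := by
  split_ifs with heq
  · subst heq; simp [taylorTerm]
  · obtain ⟨k, hk⟩ : ∃ k, δ k < α k := by
      by_contra! hle
      refine heq (funext fun k => ?_)
      have h1 := (Finset.sum_eq_sum_iff_of_le fun i _ => hle i).1
        (le_antisymm (Finset.sum_le_sum fun i _ => hle i) h)
      exact (h1 k (Finset.mem_univ k)).symm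
    exact Finset.prod_eq_zero (Finset.mem_univ k) (if_neg (not_le.2 hk))

/-- The partial derivative of order `α` of the polynomial with derivatives `A δ` at `x`. -/
noncomputable def taylorJet (q : ℕ) (A : (Fin d → ℕ) → ℝ) (x : Fin d → ℝ) (α : Fin d → ℕ)
    (y : Fin d → ℝ) : ℝ :=
  ∑ δ ∈ lowIndices d q, A δ * ∏ k, taylorTerm (δ k) (α k) (y k - x k)

lemma isJet_taylorJet (q m : ℕ) (A : (Fin d → ℕ) → ℝ) (x : Fin d → ℝ) :
    IsJet m (taylorJet q A x) := by
  refine IsJet.sum (S := lowIndices d q) A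
    (G := fun δ α y => ∏ k, taylorTerm (δ k) (α k) (y k - x k)) fun δ _ => ?_
  refine IsJet.prod (g := fun k a t => taylorTerm (δ k) a (t - x k)) fun k a _ t => ?_
  exact (hasDerivAt_taylorTerm (δ k) a (t - x k)).comp_sub_const t (x k)

lemma taylorJet_self {q : ℕ} {A : (Fin d → ℕ) → ℝ} {x : Fin d → ℝ} {α : Fin d → ℕ}
    (hα : ∑ k, α k ≤ q) : taylorJet q A x α x = A α := by
  simp only [taylorJet, sub_self, prod_taylorTerm_zero, mul_ite, mul_one, mul_zero]
  rw [Finset.sum_ite_eq', if_pos (mem_lowIndices.2 hα)]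

lemma taylorJet_of_sum_eq {q : ℕ} {A : (Fin d → ℕ) → ℝ} {x : Fin d → ℝ} {α : Fin d → ℕ}
    (hα : ∑ k, α k = q) (y : Fin d → ℝ) : taylorJet q A x α y = A α := by
  rw [← taylorJet_self (A := A) (x := x) hα.le]
  refine Finset.sum_congr rfl fun δ hδ => ?_
  rw [prod_taylorTerm_of_sum_le (hα ▸ mem_lowIndices.1 hδ),
    prod_taylorTerm_of_sum_le (hα ▸ mem_lowIndices.1 hδ)]

lemma taylorJet_of_lt_sum {q : ℕ} {A : (Fin d → ℕ) → ℝ} {x : Fin d → ℝ} {α : Fin d → ℕ}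
    (hα : q < ∑ k, α k) (y : Fin d → ℝ) : taylorJet q A x α y = 0 := by
  refine Finset.sum_eq_zero fun δ hδ => ?_
  have hlt := (mem_lowIndices.1 hδ).trans_lt hα
  rw [prod_taylorTerm_of_sum_le hlt.le, if_neg (fun h : δ = α => hlt.ne (by rw [h])), mul_zero]

lemma abs_sub_taylorJet_le {q : ℕ} {F : (Fin d → ℕ) → (Fin d → ℝ) → ℝ} {H : ℝ}
    {x : Fin d → ℝ} (hF : IsJet q F) (hx : x ∈ cube d)
    (hlip : ∀ α, ∑ k, α k = q → ∀ y ∈ cube d, |F α y - F α x| ≤ H * ∑ k, |y k - x k|)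
    {c : ℕ} {α : Fin d → ℕ} (hα : ∑ k, α k + c = q) {y : Fin d → ℝ} (hy : y ∈ cube d) :
    |F α y - taylorJet q (fun δ => F δ x) x α y| ≤
      H * ((∑ k, |y k - x k|) ^ (c + 1) / (c + 1).factorial) := by
  have hE := hF.sub (isJet_taylorJet q q (fun δ => F δ x) x)
  set E : (Fin d → ℕ) → (Fin d → ℝ) → ℝ := fun κ y => F κ y - taylorJet q (fun δ => F δ x) x κ y
    with hEdef
  show |E α y| ≤ _
  induction c generalizing α y with
  | zero =>
    rw [hEdef]
    simpa [taylorJet_of_sum_eq (show ∑ k, α k = q by omega)] using hlip α (by omega) y hy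
  | succ c ih =>
    set ρ := ∑ k, |y k - x k| with hρ
    have hline (t : ℝ) : HasDerivAt (fun t : ℝ => x + t • (y - x)) (y - x) t := by
      simpa using ((hasDerivAt_id t).smul_const (y - x)).const_add x
    have hcube : ∀ t ∈ Set.Icc (0 : ℝ) 1, x + t • (y - x) ∈ cube d := fun t ht =>
      (convex_Icc (0 : Fin d → ℝ) 1).add_smul_sub_mem hx hy ht
    have hderiv (t : ℝ) : HasDerivAt (fun t : ℝ => E α (x + t • (y - x)))
        (∑ i, E (α + Pi.single i 1) (x + t • (y - x)) * (y i - x i)) t := by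
      refine ((hE α (by omega) (x + t • (y - x))).comp_hasDerivAt t (hline t)).congr_deriv ?_
      simp
    have hbound : ∀ t ∈ Set.Ico (0 : ℝ) 1,
        ‖∑ i, E (α + Pi.single i 1) (x + t • (y - x)) * (y i - x i)‖ ≤
          H * ((t ^ (c + 1) * ρ ^ (c + 2)) / (c + 1).factorial) := by
      intro t ht
      have hsum : ∑ k, |(x + t • (y - x)) k - x k| = t * ρ := by
        rw [hρ, Finset.mul_sum]
        refine Finset.sum_congr rfl fun k _ => ?_
        simp [abs_mul, abs_of_nonneg ht.1]
      refine (norm_sum_le _ _).trans ?_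
      calc _ ≤ ∑ i, H * ((t * ρ) ^ (c + 1) / (c + 1).factorial) * |y i - x i| := by
            refine Finset.sum_le_sum fun i _ => ?_
            rw [norm_mul, Real.norm_eq_abs, Real.norm_eq_abs, ← hsum]
            refine mul_le_mul_of_nonneg_right (ih ?_ (hcube t ⟨ht.1, ht.2.le⟩)) (abs_nonneg _)
            simp only [Pi.add_apply, Finset.sum_add_distrib, Finset.sum_pi_single',
              Finset.mem_univ, if_true]
            omega
        _ = _ := by rw [← Finset.mul_sum, ← hρ, mul_pow]; ring
    have hB (t : ℝ) : HasDerivAt (fun t : ℝ => H * ((t ^ (c + 2) * ρ ^ (c + 2)) /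
        (c + 2).factorial)) (H * ((t ^ (c + 1) * ρ ^ (c + 2)) / (c + 1).factorial)) t := by
      refine ((((hasDerivAt_pow (c + 2) t).mul_const (ρ ^ (c + 2))).div_const _).const_mul
        H).congr_deriv ?_
      rw [Nat.factorial_succ (c + 1)]
      push_cast
      field_simp
      ring
    have hfin := image_norm_le_of_norm_deriv_right_le_deriv_boundary
      (f := fun t : ℝ => E α (x + t • (y - x))) (a := 0) (b := 1)
      (fun t _ => (hderiv t).continuousAt.continuousWithinAt)
      (fun t _ => (hderiv t).hasDerivWithinAt)
      (by simp [hEdef, taylorJet_self (show ∑ k, α k ≤ q by omega)]) hB hbound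
      (Set.right_mem_Icc.2 zero_le_one)
    simpa using hfin

end Taylor

section SplineInterpolation

variable {d : ℕ}

lemma sum_piAntidiag_prod_inv_factorial (k : ℕ) :
    ∑ α ∈ Finset.piAntidiag (Finset.univ : Finset (Fin d)) k, ∏ i, ((α i).factorial : ℝ)⁻¹ =
      (d : ℝ) ^ k / k.factorial := by
  have h := Finset.sum_pow_eq_sum_piAntidiag (Finset.univ : Finset (Fin d)) (fun _ => (1 : ℝ)) k
  simp only [Finset.sum_const, Finset.card_univ, Fintype.card_fin, nsmul_eq_mul, mul_one,
    one_pow, Finset.prod_const_one] at h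
  rw [h, Finset.sum_div]
  refine Finset.sum_congr rfl fun α hα => ?_
  have h1 := Nat.multinomial_spec (Finset.univ : Finset (Fin d)) α
  rw [(Finset.mem_piAntidiag.1 hα).1] at h1
  have h2 : (∏ i, ((α i).factorial : ℝ)) * Nat.multinomial Finset.univ α = k.factorial := by
    exact_mod_cast h1
  have h3 : (∏ i, ((α i).factorial : ℝ)) ≠ 0 :=
    Finset.prod_ne_zero_iff.2 fun i _ => by positivity
  rw [Finset.prod_inv_distrib, eq_div_iff (by positivity), ← h2]
  field_simp

lemma sum_lowIndices_le (q : ℕ) :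
    ∑ α ∈ lowIndices d q, (d : ℝ) ^ (q + 1 - ∑ k, α k) / (q + 1 - ∑ k, α k).factorial *
      ∏ k, ((α k).factorial : ℝ)⁻¹ ≤ (2 * d) ^ (q + 1) / (q + 1).factorial := by
  have h1 : ∀ α ∈ lowIndices d q, ∑ k, α k ∈ Finset.range (q + 1) := fun α hα =>
    Finset.mem_range.2 (Nat.lt_succ_of_le (mem_lowIndices.1 hα))
  have h2 : ∀ j ∈ Finset.range (q + 1), ∑ α ∈ lowIndices d q with ∑ k, α k = j,
      (d : ℝ) ^ (q + 1 - ∑ k, α k) / (q + 1 - ∑ k, α k).factorial *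
        ∏ k, ((α k).factorial : ℝ)⁻¹ =
      d ^ (q + 1) / (q + 1).factorial * (q + 1).choose j := by
    intro j hj
    have hj : j ≤ q := Nat.lt_succ_iff.1 (Finset.mem_range.1 hj)
    have h3 : (lowIndices d q).filter (fun α => ∑ k, α k = j) =
        Finset.piAntidiag Finset.univ j := by
      ext α
      simp only [Finset.mem_filter, mem_lowIndices, Finset.mem_piAntidiag, Finset.mem_univ,
        implies_true, and_true]
      exact ⟨fun h => h.2, fun h => ⟨h.le.trans hj, h⟩⟩
    calc _ = ∑ α ∈ Finset.piAntidiag Finset.univ j, (d : ℝ) ^ (q + 1 - j) /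
          (q + 1 - j).factorial * ∏ k : Fin d, ((α k).factorial : ℝ)⁻¹ := by
          rw [h3]
          refine Finset.sum_congr rfl fun α hα => ?_
          rw [(Finset.mem_piAntidiag.1 hα).1]
      _ = _ := by
          rw [← Finset.mul_sum, sum_piAntidiag_prod_inv_factorial,
            Nat.cast_choose ℝ (show j ≤ q + 1 by omega)]
          rw [show (d : ℝ) ^ (q + 1) = d ^ (q + 1 - j) * d ^ j by
            rw [← pow_add]; congr 1; omega]
          field_simp
  rw [← Finset.sum_fiberwise_of_maps_to h1, Finset.sum_congr rfl h2, ← Finset.mul_sum, mul_pow,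
    mul_comm ((2 : ℝ) ^ (q + 1)), mul_div_right_comm]
  refine mul_le_mul_of_nonneg_left ?_ (by positivity)
  have h4 := Nat.sum_range_choose (q + 1)
  rw [Finset.sum_range_succ] at h4
  exact_mod_cast le_of_add_le_left h4.le

/-- The point of index `β` of the uniform grid. -/
noncomputable def gridPoint (n : ℕ) (β : Fin d → ℕ) : Fin d → ℝ := fun k => β k / n

/-- The multi-indices of the grid points at which the splines interpolate. -/
def gridIndices (d n : ℕ) : Finset (Fin d → ℕ) := Fintype.piFinset fun _ => Finset.range n

lemma gridPoint_mem_cube {n : ℕ} {β : Fin d → ℕ} (hβ : β ∈ gridIndices d n) :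
    gridPoint n β ∈ cube d := by
  have h (k : Fin d) : β k < n := Finset.mem_range.1 (Fintype.mem_piFinset.1 hβ k)
  refine ⟨fun k => by simp only [gridPoint, Pi.zero_apply]; positivity, fun k => ?_⟩
  exact div_le_one_of_le₀ (Nat.cast_le.2 (h k).le) (by positivity)

/-- The coefficients of the interpolating tensor product spline. -/
noncomputable def interpCoeff (q n : ℕ) (F : (Fin d → ℕ) → (Fin d → ℝ) → ℝ)
    (J : Fin d → Fin n × Fin (q + 1)) : ℝ :=
  ∑ α ∈ lowIndices d q, ∑ β ∈ gridIndices d n,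
    F α (gridPoint n β) * ∏ k, splineCoeff q n (β k) (α k) (J k)

/-- The partial derivative of order `γ` of the interpolating tensor product spline. -/
noncomputable def interpSpline (q n : ℕ) (F : (Fin d → ℕ) → (Fin d → ℝ) → ℝ) (γ : Fin d → ℕ)
    (x : Fin d → ℝ) : ℝ :=
  ∑ J, interpCoeff q n F J * ∏ k, truncPow q (γ k) (blockNode q n (J k).1 (J k).2) (x k)

lemma interpSpline_eq {q n : ℕ} (F : (Fin d → ℕ) → (Fin d → ℝ) → ℝ) (γ : Fin d → ℕ)
    (x : Fin d → ℝ) :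
    interpSpline q n F γ x = ∑ α ∈ lowIndices d q, ∑ β ∈ gridIndices d n,
      F α (gridPoint n β) * ∏ k, splineBasis q n (β k) (α k) (γ k) (x k) := by
  simp only [interpSpline, interpCoeff, splineBasis, Finset.prod_univ_sum, Fintype.piFinset_univ,
    Finset.sum_mul, Finset.mul_sum]
  rw [Finset.sum_comm]
  refine Finset.sum_congr rfl fun α _ => ?_
  rw [Finset.sum_comm]
  refine Finset.sum_congr rfl fun β _ => Finset.sum_congr rfl fun J _ => ?_
  rw [Finset.prod_mul_distrib, mul_assoc]

lemma sum_sum_prod_eq (q n : ℕ) (g : Fin d → ℕ → ℕ → ℝ) :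
    ∑ α ∈ Fintype.piFinset fun _ : Fin d => Finset.range (q + 1), ∑ β ∈ gridIndices d n,
      ∏ k, g k (α k) (β k) =
      ∏ k, ∑ a ∈ Finset.range (q + 1), ∑ b ∈ Finset.range n, g k a b := by
  rw [Finset.prod_univ_sum]
  refine Finset.sum_congr rfl fun α _ => ?_
  rw [Finset.prod_univ_sum, gridIndices]

lemma abs_interpCoeff_le {q n : ℕ} (hn : 1 ≤ n) {F : (Fin d → ℕ) → (Fin d → ℝ) → ℝ} {H : ℝ}
    (hH : 0 ≤ H) (hF : ∀ α, ∑ k, α k ≤ q → ∀ y ∈ cube d, |F α y| ≤ H)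
    (J : Fin d → Fin n × Fin (q + 1)) :
    |interpCoeff q n F J| ≤ H * (6 ^ (q + 1) * n ^ q) ^ d := by
  calc |interpCoeff q n F J|
      ≤ ∑ α ∈ lowIndices d q, ∑ β ∈ gridIndices d n,
          H * ∏ k, |splineCoeff q n (β k) (α k) (J k)| := by
        refine (Finset.abs_sum_le_sum_abs _ _).trans (Finset.sum_le_sum fun α hα => ?_)
        refine (Finset.abs_sum_le_sum_abs _ _).trans (Finset.sum_le_sum fun β hβ => ?_)
        rw [abs_mul, Finset.abs_prod]
        exact mul_le_mul_of_nonneg_right (hF α (mem_lowIndices.1 hα) _ (gridPoint_mem_cube hβ))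
          (Finset.prod_nonneg fun _ _ => abs_nonneg _)
    _ ≤ ∑ α ∈ Fintype.piFinset fun _ : Fin d => Finset.range (q + 1), ∑ β ∈ gridIndices d n,
          H * ∏ k, |splineCoeff q n (β k) (α k) (J k)| :=
        Finset.sum_le_sum_of_subset_of_nonneg (Finset.filter_subset _ _) fun α _ _ =>
          Finset.sum_nonneg fun β _ =>
            mul_nonneg hH (Finset.prod_nonneg fun _ _ => abs_nonneg _)
    _ = H * ∏ k, ∑ a ∈ Finset.range (q + 1), ∑ b ∈ Finset.range n,
          |splineCoeff q n b a (J k)| := by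
        simp only [← Finset.mul_sum]
        rw [sum_sum_prod_eq q n fun k a b => |splineCoeff q n b a (J k)|]
    _ ≤ H * ∏ _k : Fin d, (6 ^ (q + 1) * (n : ℝ) ^ q) := by
        refine mul_le_mul_of_nonneg_left (Finset.prod_le_prod (fun k _ => ?_) fun k _ =>
          sum_abs_splineCoeff_le hn (J k)) hH
        exact Finset.sum_nonneg fun _ _ => Finset.sum_nonneg fun _ _ => abs_nonneg _
    _ = _ := by simp

lemma sum_taylorJet_mul_splineBasis {q n : ℕ} (hn : 1 ≤ n) (A : (Fin d → ℕ) → ℝ)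
    {x : Fin d → ℝ} (hx : x ∈ cube d) {γ : Fin d → ℕ} (hγ : ∑ k, γ k ≤ q) :
    ∑ α ∈ lowIndices d q, ∑ β ∈ gridIndices d n, taylorJet q A x α (gridPoint n β) *
      ∏ k, splineBasis q n (β k) (α k) (γ k) (x k) = A γ := by
  have hγk (k : Fin d) : γ k ≤ q :=
    (Finset.single_le_sum (fun _ _ => Nat.zero_le _) (Finset.mem_univ k)).trans hγ
  have h1 : ∑ α ∈ lowIndices d q, ∑ β ∈ gridIndices d n, taylorJet q A x α (gridPoint n β) *
      ∏ k, splineBasis q n (β k) (α k) (γ k) (x k) =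
      ∑ α ∈ Fintype.piFinset fun _ : Fin d => Finset.range (q + 1), ∑ β ∈ gridIndices d n,
        taylorJet q A x α (gridPoint n β) *
          ∏ k, splineBasis q n (β k) (α k) (γ k) (x k) := by
    refine Finset.sum_subset (Finset.filter_subset _ _) fun α _ hα => ?_
    refine Finset.sum_eq_zero fun β _ => ?_
    rw [taylorJet_of_lt_sum (not_le.1 fun h => hα (mem_lowIndices.2 h)), zero_mul]
  have h2 : ∑ α ∈ Fintype.piFinset fun _ : Fin d => Finset.range (q + 1), ∑ β ∈ gridIndices d n,
      taylorJet q A x α (gridPoint n β) * ∏ k, splineBasis q n (β k) (α k) (γ k) (x k) =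
      ∑ δ ∈ lowIndices d q, A δ * ∑ α ∈ Fintype.piFinset fun _ : Fin d => Finset.range (q + 1),
        ∑ β ∈ gridIndices d n, ∏ k, taylorTerm (δ k) (α k) (β k / n - x k) *
          splineBasis q n (β k) (α k) (γ k) (x k) := by
    simp only [Finset.mul_sum]
    rw [Finset.sum_comm (s := lowIndices d q)]
    refine Finset.sum_congr rfl fun α _ => ?_
    rw [Finset.sum_comm]
    refine Finset.sum_congr rfl fun β _ => ?_
    rw [taylorJet, Finset.sum_mul]
    refine Finset.sum_congr rfl fun δ _ => ?_
    rw [Finset.prod_mul_distrib, mul_assoc]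
    rfl
  rw [h1, h2]
  have h3 : ∀ δ ∈ lowIndices d q, ∑ α ∈ Fintype.piFinset fun _ : Fin d => Finset.range (q + 1),
        ∑ β ∈ gridIndices d n, ∏ k, taylorTerm (δ k) (α k) (β k / n - x k) *
          splineBasis q n (β k) (α k) (γ k) (x k) = if δ = γ then 1 else 0 := by
    intro δ hδ
    have hδk (k : Fin d) : δ k ≤ q :=
      (Finset.single_le_sum (fun _ _ => Nat.zero_le _) (Finset.mem_univ k)).trans
        (mem_lowIndices.1 hδ)
    rw [sum_sum_prod_eq q n fun k a b => taylorTerm (δ k) a (b / n - x k) *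
      splineBasis q n b a (γ k) (x k)]
    have h4 (k : Fin d) : ∑ a ∈ Finset.range (q + 1), ∑ b ∈ Finset.range n,
        taylorTerm (δ k) a (b / n - x k) * splineBasis q n b a (γ k) (x k) =
          if δ k = γ k then 1 else 0 :=
      sum_taylorTerm_mul_splineBasis hn (hδk k) (hγk k) (hx.1 k)
    simp only [h4]
    split_ifs with h
    · simp [h]
    · obtain ⟨k, hk⟩ := Function.ne_iff.1 h
      exact Finset.prod_eq_zero (Finset.mem_univ k) (if_neg hk)
  rw [Finset.sum_congr rfl fun δ hδ => by rw [h3 δ hδ, mul_ite, mul_one, mul_zero],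
    Finset.sum_ite_eq', if_pos (mem_lowIndices.2 hγ)]

end SplineInterpolation

section ApproximationError

variable {d : ℕ}

lemma abs_sub_interpSpline_le {q n : ℕ} (hn : 1 ≤ n) {F : (Fin d → ℕ) → (Fin d → ℝ) → ℝ} {H : ℝ}
    (hH : 0 ≤ H) (hF : IsJet q F)
    (hlip : ∀ α, ∑ k, α k = q → ∀ x ∈ cube d, ∀ y ∈ cube d,
      |F α y - F α x| ≤ H * ∑ k, |y k - x k|)
    {x : Fin d → ℝ} (hx : x ∈ cube d) {γ : Fin d → ℕ} (hγ : ∑ k, γ k ≤ q) :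
    (n : ℝ)⁻¹ ^ (∑ k, γ k) * |F γ x - interpSpline q n F γ x| ≤
      H * ((2 * d) ^ (q + 1) / (q + 1).factorial) * (n : ℝ)⁻¹ ^ (q + 1) *
        (q ^ (∑ k, γ k) * (3 * 6 ^ q) ^ d) := by
  have hγk (k : Fin d) : γ k ≤ q :=
    (Finset.single_le_sum (fun _ _ => Nat.zero_le _) (Finset.mem_univ k)).trans hγ
  have hx' (k : Fin d) : x k ∈ Set.Icc (0 : ℝ) 1 := ⟨hx.1 k, hx.2 k⟩
  set h : ℝ := (n : ℝ)⁻¹ with hh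
  have hh0 : 0 ≤ h := by positivity
  set T := taylorJet q (fun δ => F δ x) x with hT
  have hdiff : F γ x - interpSpline q n F γ x = ∑ α ∈ lowIndices d q, ∑ β ∈ gridIndices d n,
      -(F α (gridPoint n β) - T α (gridPoint n β)) *
        ∏ k, splineBasis q n (β k) (α k) (γ k) (x k) := by
    rw [interpSpline_eq, ← sum_taylorJet_mul_splineBasis hn (fun δ => F δ x) hx hγ,
      ← Finset.sum_sub_distrib]
    refine Finset.sum_congr rfl fun α _ => ?_
    rw [← Finset.sum_sub_distrib]
    exact Finset.sum_congr rfl fun β _ => by ring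
  have hterm : ∀ α ∈ lowIndices d q, ∀ β ∈ gridIndices d n,
      |-(F α (gridPoint n β) - T α (gridPoint n β)) *
        ∏ k, splineBasis q n (β k) (α k) (γ k) (x k)| ≤
      H * ((d * h) ^ (q + 1 - ∑ k, α k) / (q + 1 - ∑ k, α k).factorial) *
        ∏ k, |splineBasis q n (β k) (α k) (γ k) (x k)| := by
    intro α hα β hβ
    have hα := mem_lowIndices.1 hα
    have hβn (k : Fin d) : β k < n := Finset.mem_range.1 (Fintype.mem_piFinset.1 hβ k)
    have hαk (k : Fin d) : α k ≤ q :=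
      (Finset.single_le_sum (fun _ _ => Nat.zero_le _) (Finset.mem_univ k)).trans hα
    rw [abs_mul, abs_neg, Finset.abs_prod]
    by_cases hne : ∀ k, splineBasis q n (β k) (α k) (γ k) (x k) ≠ 0
    · refine mul_le_mul_of_nonneg_right ?_ (Finset.prod_nonneg fun _ _ => abs_nonneg _)
      have h1 := abs_sub_taylorJet_le hF hx (hlip · · x hx) (c := q - ∑ k, α k) (α := α)
        (by omega) (gridPoint_mem_cube hβ)
      rw [show q - ∑ k, α k + 1 = q + 1 - ∑ k, α k by omega] at h1
      refine h1.trans ?_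
      have h2 : ∑ k, |gridPoint n β k - x k| ≤ d * h := by
        refine (Finset.sum_le_card_nsmul _ _ h fun k _ =>
          (exists_splineBasis_bound hn (hx' k) (hγk k)).1 _ (hαk k) _ (hβn k) (hne k)).trans ?_
        simp
      have h3 : 0 ≤ ∑ k, |gridPoint n β k - x k| := Finset.sum_nonneg fun _ _ => abs_nonneg _
      gcongr
    · push Not at hne
      obtain ⟨k, hk⟩ := hne
      rw [Finset.prod_eq_zero (Finset.mem_univ k) (by rw [hk, abs_zero]), mul_zero, mul_zero]
  have hprod : ∀ α ∈ lowIndices d q, h ^ (∑ k, γ k) * ∑ β ∈ gridIndices d n,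
      ∏ k, |splineBasis q n (β k) (α k) (γ k) (x k)| ≤
      h ^ (∑ k, α k) * (∏ k, ((α k).factorial : ℝ)⁻¹) *
        (q ^ (∑ k, γ k) * (3 * 6 ^ q) ^ d) := by
    intro α hα
    have hα := mem_lowIndices.1 hα
    have hαk (k : Fin d) : α k ≤ q :=
      (Finset.single_le_sum (fun _ _ => Nat.zero_le _) (Finset.mem_univ k)).trans hα
    have h1 : ∑ β ∈ gridIndices d n, ∏ k, |splineBasis q n (β k) (α k) (γ k) (x k)| =
        ∏ k, ∑ b ∈ Finset.range n, |splineBasis q n b (α k) (γ k) (x k)| := by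
      rw [Finset.prod_univ_sum, gridIndices]
    rw [h1, ← Finset.prod_pow_eq_pow_sum, ← Finset.prod_mul_distrib]
    refine (Finset.prod_le_prod (fun k _ => mul_nonneg (by positivity)
      (Finset.sum_nonneg fun _ _ => abs_nonneg _)) fun k _ =>
      (exists_splineBasis_bound hn (hx' k) (hγk k)).2 _ (hαk k)).trans (le_of_eq ?_)
    simp only [← hh, div_eq_mul_inv, Finset.prod_mul_distrib, Finset.prod_pow_eq_pow_sum,
      Finset.prod_const, Finset.sum_const, smul_eq_mul, Finset.card_univ, Fintype.card_fin]
    ring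
  set D : ℝ := q ^ (∑ k, γ k) * (3 * 6 ^ q) ^ d with hD
  calc h ^ (∑ k, γ k) * |F γ x - interpSpline q n F γ x|
      ≤ h ^ (∑ k, γ k) * ∑ α ∈ lowIndices d q, ∑ β ∈ gridIndices d n,
        H * ((d * h) ^ (q + 1 - ∑ k, α k) / (q + 1 - ∑ k, α k).factorial) *
          ∏ k, |splineBasis q n (β k) (α k) (γ k) (x k)| := by
        rw [hdiff]
        refine mul_le_mul_of_nonneg_left ?_ (by positivity)
        exact (Finset.abs_sum_le_sum_abs _ _).trans (Finset.sum_le_sum fun α hα =>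
          (Finset.abs_sum_le_sum_abs _ _).trans (Finset.sum_le_sum fun β hβ => hterm α hα β hβ))
    _ = ∑ α ∈ lowIndices d q,
        H * ((d * h) ^ (q + 1 - ∑ k, α k) / (q + 1 - ∑ k, α k).factorial) *
          (h ^ (∑ k, γ k) * ∑ β ∈ gridIndices d n,
            ∏ k, |splineBasis q n (β k) (α k) (γ k) (x k)|) := by
        rw [Finset.mul_sum]
        refine Finset.sum_congr rfl fun α _ => ?_
        rw [← Finset.mul_sum]; ring
    _ ≤ ∑ α ∈ lowIndices d q,
        H * ((d * h) ^ (q + 1 - ∑ k, α k) / (q + 1 - ∑ k, α k).factorial) *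
          (h ^ (∑ k, α k) * (∏ k, ((α k).factorial : ℝ)⁻¹) * D) :=
        Finset.sum_le_sum fun α hα => mul_le_mul_of_nonneg_left (hprod α hα) (by positivity)
    _ = H * h ^ (q + 1) * D * ∑ α ∈ lowIndices d q,
        (d : ℝ) ^ (q + 1 - ∑ k, α k) / (q + 1 - ∑ k, α k).factorial *
          ∏ k, ((α k).factorial : ℝ)⁻¹ := by
        rw [Finset.mul_sum]
        refine Finset.sum_congr rfl fun α hα => ?_
        have h1 : h ^ (q + 1) = h ^ (q + 1 - ∑ k, α k) * h ^ (∑ k, α k) := by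
          rw [← pow_add]; congr 1; have := mem_lowIndices.1 hα; omega
        rw [h1, mul_pow]; ring
    _ ≤ H * h ^ (q + 1) * D * ((2 * d) ^ (q + 1) / (q + 1).factorial) :=
        mul_le_mul_of_nonneg_left (sum_lowIndices_le q) (by positivity)
    _ = _ := by ring

lemma update_mem_cube {z : Fin d → ℝ} (hz : z ∈ cube d) (i : Fin d) {t : ℝ}
    (ht : t ∈ Set.Icc (0 : ℝ) 1) : Function.update z i t ∈ cube d := by
  constructor <;> intro k <;> by_cases hk : k = i
  · subst hk; simpa using ht.1
  · simpa [hk] using hz.1 k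
  · subst hk; simpa using ht.2
  · simpa [hk] using hz.2 k

lemma abs_sub_le_of_right_partial_deriv {g : (Fin d → ℝ) → ℝ} {g' : Fin d → (Fin d → ℝ) → ℝ}
    {B : ℝ} (hcont : ∀ i z, Continuous fun t : ℝ => g (Function.update z i t))
    (hder : ∀ i z t, HasDerivWithinAt (fun t : ℝ => g (Function.update z i t))
      (g' i (Function.update z i t)) (Set.Ici t) t)
    (hB : ∀ i, ∀ z ∈ cube d, |g' i z| ≤ B) {x y : Fin d → ℝ} (hx : x ∈ cube d)
    (hy : y ∈ cube d) : |g y - g x| ≤ B * ∑ k, |y k - x k| := by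
  have hle (i : Fin d) {z : Fin d → ℝ} (hz : z ∈ cube d) {a b : ℝ} (ha : 0 ≤ a) (hab : a ≤ b)
      (hb : b ≤ 1) : |g (Function.update z i b) - g (Function.update z i a)| ≤ B * (b - a) :=
    norm_image_sub_le_of_norm_deriv_right_le_segment
      (f := fun t : ℝ => g (Function.update z i t)) (hcont i z).continuousOn
      (fun t _ => hder i z t)
      (fun t ht => hB i _ (update_mem_cube hz i ⟨ha.trans ht.1, ht.2.le.trans hb⟩))
      b (Set.right_mem_Icc.2 hab)
  have hstep (i : Fin d) {z : Fin d → ℝ} (hz : z ∈ cube d) {a b : ℝ}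
      (ha : a ∈ Set.Icc (0 : ℝ) 1) (hb : b ∈ Set.Icc (0 : ℝ) 1) :
      |g (Function.update z i b) - g (Function.update z i a)| ≤ B * |b - a| := by
    rcases le_total a b with h | h
    · rw [abs_of_nonneg (sub_nonneg.2 h)]
      exact hle i hz ha.1 h hb.2
    · rw [abs_sub_comm, abs_sub_comm b, abs_of_nonneg (sub_nonneg.2 h)]
      exact hle i hz hb.1 h ha.2
  have hmem (S : Finset (Fin d)) : S.piecewise y x ∈ cube d := by
    constructor <;> intro k <;> by_cases hk : k ∈ S <;> simp only [hk, Finset.piecewise,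
      if_true, if_false]
    exacts [hy.1 k, hx.1 k, hy.2 k, hx.2 k]
  have hS (S : Finset (Fin d)) :
      |g (S.piecewise y x) - g x| ≤ B * ∑ k ∈ S, |y k - x k| := by
    induction S using Finset.induction_on with
    | empty => simp
    | insert i S hi ih =>
      have h1 := hstep i (hmem S) (a := x i) (b := y i) ⟨hx.1 i, hx.2 i⟩ ⟨hy.1 i, hy.2 i⟩
      have h2 : Function.update (S.piecewise y x) i (x i) = S.piecewise y x := by
        rw [Function.update_eq_self_iff]; simp [hi]
      rw [h2] at h1
      rw [Finset.piecewise_insert, Finset.sum_insert hi, mul_add]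
      exact (abs_sub_le _ _ _).trans (add_le_add h1 ih)
  simpa using hS Finset.univ

lemma prod_update_eq {g : Fin d → ℕ → ℝ → ℝ} (κ : Fin d → ℕ) (z : Fin d → ℝ) (i : Fin d)
    (t : ℝ) : ∏ k, g k (κ k) (Function.update z i t k) =
      g i (κ i) t * ∏ k ∈ Finset.univ.erase i, g k (κ k) (z k) := by
  rw [← Finset.mul_prod_erase _ _ (Finset.mem_univ i), Function.update_self]
  congr 1
  refine Finset.prod_congr rfl fun k hk => ?_
  rw [Function.update_of_ne (Finset.ne_of_mem_erase hk)]

lemma continuous_interpSpline_update {q n : ℕ} (F : (Fin d → ℕ) → (Fin d → ℝ) → ℝ)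
    {γ : Fin d → ℕ} (i : Fin d) (hγ : γ i < q) (z : Fin d → ℝ) :
    Continuous fun t : ℝ => interpSpline q n F γ (Function.update z i t) := by
  refine continuous_finsetSum _ fun J _ => continuous_const.mul ?_
  simp only [prod_update_eq (g := fun k a => truncPow q a (blockNode q n (J k).1 (J k).2))]
  exact (continuous_truncPow hγ _).mul continuous_const

lemma hasDerivWithinAt_interpSpline_update {q n : ℕ} (F : (Fin d → ℕ) → (Fin d → ℝ) → ℝ)
    (γ : Fin d → ℕ) (i : Fin d) (z : Fin d → ℝ) (t : ℝ) :
    HasDerivWithinAt (fun t : ℝ => interpSpline q n F γ (Function.update z i t))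
      (interpSpline q n F (γ + Pi.single i 1) (Function.update z i t)) (Set.Ici t) t := by
  refine HasDerivWithinAt.fun_sum fun J _ => HasDerivWithinAt.const_mul _ ?_
  simp only [prod_update_eq (g := fun k a => truncPow q a (blockNode q n (J k).1 (J k).2))]
  have h1 : ∏ k ∈ Finset.univ.erase i, truncPow q ((γ + Pi.single i 1 : Fin d → ℕ) k)
      (blockNode q n (J k).1 (J k).2) (z k) = ∏ k ∈ Finset.univ.erase i, truncPow q (γ k)
      (blockNode q n (J k).1 (J k).2) (z k) := by
    refine Finset.prod_congr rfl fun k hk => ?_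
    rw [Pi.add_apply, Pi.single_eq_of_ne (Finset.ne_of_mem_erase hk), add_zero]
  rw [h1, Pi.add_apply, Pi.single_eq_same]
  exact (hasDerivWithinAt_truncPow q (γ i) _ t).mul_const _

lemma isJet_interpSpline (q n : ℕ) (F : (Fin d → ℕ) → (Fin d → ℝ) → ℝ) :
    IsJet (q - 1) (interpSpline q n F) := by
  refine IsJet.sum (interpCoeff q n F) (G := fun J κ x => ∏ k, truncPow q (κ k)
    (blockNode q n (J k).1 (J k).2) (x k)) fun J _ => ?_
  exact IsJet.prod (g := fun k a => truncPow q a (blockNode q n (J k).1 (J k).2))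
    fun k a ha t => hasDerivAt_truncPow (by omega) _ t

lemma eucDist_le_sum (x y : Fin d → ℝ) : eucDist x y ≤ ∑ k, |x k - y k| := by
  refine Real.sqrt_le_iff.2 ⟨Finset.sum_nonneg fun _ _ => abs_nonneg _, ?_⟩
  simp only [← sq_abs (x _ - y _)]
  exact Finset.sum_sq_le_sq_sum_of_nonneg fun _ _ => abs_nonneg _

lemma sum_abs_sub_le {x y : Fin d → ℝ} (hx : x ∈ cube d) (hy : y ∈ cube d) :
    ∑ k, |x k - y k| ≤ d * min 1 (eucDist x y) := by
  refine (Finset.sum_le_card_nsmul _ _ (min 1 (eucDist x y)) fun k _ => le_min ?_ ?_).trans ?_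
  · have := hx.1 k; have := hx.2 k; have := hy.1 k; have := hy.2 k
    simp only [Pi.zero_apply, Pi.one_apply] at *
    rw [abs_le]; constructor <;> linarith
  · exact Real.abs_le_sqrt (Finset.single_le_sum
      (f := fun i => (x i - y i) ^ 2) (fun _ _ => sq_nonneg _) (Finset.mem_univ k))
  · simp

lemma zero_mem_cube : (0 : Fin d → ℝ) ∈ cube d := ⟨le_rfl, zero_le_one⟩

lemma holderNormLeOn_sub_interpSpline {q n ℓ : ℕ} (hd : 0 < d) (hn : 1 ≤ n) (hℓ : ℓ ≤ q)
    (hq : 1 ≤ q) {g : (Fin d → ℝ) → ℝ} (hg : ContDiff ℝ (⊤ : ℕ∞) g) {H : ℝ}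
    (hH : HolderNormLeOn (cube d) (q + 1) g H) :
    HolderNormLeOn (cube d) ℓ (fun x => g x - interpSpline q n (fun κ => mderiv κ g) 0 x)
      (d * (H * ((2 * d) ^ (q + 1) / (q + 1).factorial) * (n : ℝ)⁻¹ ^ (q + 1 - ℓ) *
        (q ^ ℓ * (3 * 6 ^ q) ^ d))) := by
  have hn' : (1 : ℝ) ≤ n := by exact_mod_cast hn
  have hH0 : 0 ≤ H := (abs_nonneg _).trans (hH.1 0 (by simp) 0 zero_mem_cube)
  have hlip : ∀ α : Fin d → ℕ, ∑ k, α k = q → ∀ x ∈ cube d, ∀ y ∈ cube d,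
      |mderiv α g y - mderiv α g x| ≤ H * ∑ k, |y k - x k| := by
    intro α hα x hx y hy
    by_cases hxy : y = x
    · simp [hxy]
    · refine (hH.2 α hα y hy x hx hxy).trans (mul_le_mul_of_nonneg_left ?_ hH0)
      exact (min_le_right _ _).trans (eucDist_le_sum y x)
  set F := fun κ => mderiv κ g with hF
  set G : (Fin d → ℕ) → (Fin d → ℝ) → ℝ := fun κ x => F κ x - interpSpline q n F κ x with hG
  set B := H * ((2 * d) ^ (q + 1) / (q + 1).factorial) * (n : ℝ)⁻¹ ^ (q + 1 - ℓ) *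
        (q ^ ℓ * (3 * 6 ^ q) ^ d) with hB
  have hB0 : 0 ≤ B := by positivity
  have hsup : ∀ γ : Fin d → ℕ, ∑ k, γ k ≤ ℓ → ∀ x ∈ cube d, |G γ x| ≤ B := by
    intro γ hγ x hx
    have h1 := abs_sub_interpSpline_le hn hH0 (isJet_mderiv hg q) hlip hx (hγ.trans hℓ)
    have h0 : (n : ℝ)⁻¹ ^ (q + 1) = (n : ℝ)⁻¹ ^ (q + 1 - ∑ k, γ k) * (n : ℝ)⁻¹ ^ (∑ k, γ k) := by
      rw [← pow_add]; congr 1; omega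
    rw [h0] at h1
    have hpos : 0 < (n : ℝ)⁻¹ ^ (∑ k, γ k) := by positivity
    have h2 : |G γ x| ≤ H * ((2 * d) ^ (q + 1) / (q + 1).factorial) *
        (n : ℝ)⁻¹ ^ (q + 1 - ∑ k, γ k) * (q ^ (∑ k, γ k) * (3 * 6 ^ q) ^ d) := by
      refine le_of_mul_le_mul_left (h1.trans (le_of_eq ?_)) hpos
      ring
    refine h2.trans ?_
    have h3 : (n : ℝ)⁻¹ ^ (q + 1 - ∑ k, γ k) ≤ (n : ℝ)⁻¹ ^ (q + 1 - ℓ) :=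
      pow_le_pow_of_le_one (by positivity) (inv_le_one_of_one_le₀ hn') (by omega)
    have h4 : (q : ℝ) ^ (∑ k, γ k) ≤ q ^ ℓ := pow_le_pow_right₀ (by exact_mod_cast hq) hγ
    rw [hB]
    gcongr
  have hd' : (1 : ℝ) ≤ d := by exact_mod_cast hd
  have hBd : B ≤ d * B := le_mul_of_one_le_left hB0 hd'
  have hG0 : (fun x => g x - interpSpline q n F 0 x) = G 0 := by
    simp [hG, hF, mderiv]
  have hGjet : IsJet (q - 1) G := (isJet_mderiv hg (q - 1)).sub (isJet_interpSpline q n F)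
  rw [hG0]
  cases ℓ with
  | zero => exact fun x hx => (hsup 0 (by simp) x hx).trans hBd
  | succ m =>
    refine ⟨fun γ hγ x hx => ?_, fun γ hγ x hx y hy _ => ?_⟩
    · rw [hGjet.mderiv_eq (by omega)]
      exact (hsup γ (by omega) x hx).trans hBd
    · rw [hGjet.mderiv_eq (by omega)]
      have hγi (i : Fin d) : γ i < q :=
        (Finset.single_le_sum (fun _ _ => Nat.zero_le _) (Finset.mem_univ i)).trans_lt
          (by omega : ∑ k, γ k < q)
      have hder (i : Fin d) (z : Fin d → ℝ) (t : ℝ) :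
          HasDerivAt (fun t : ℝ => F γ (Function.update z i t))
            (F (γ + Pi.single i 1) (Function.update z i t)) t := by
        refine ((isJet_mderiv hg q γ (by omega) (Function.update z i t)).comp_hasDerivAt t
          (hasDerivAt_update z i t)).congr_deriv ?_
        simp [Pi.single_apply, hF]
      have h1 := abs_sub_le_of_right_partial_deriv (g := G γ)
        (g' := fun i => G (γ + Pi.single i 1)) (B := B)
        (fun i z => (continuous_iff_continuousAt.2 fun t => (hder i z t).continuousAt).sub
          (continuous_interpSpline_update F i (hγi i) z))
        (fun i z t => (hder i z t).hasDerivWithinAt.sub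
          (hasDerivWithinAt_interpSpline_update F γ i z t))
        (fun i z hz => hsup _ (by simp [Finset.sum_add_distrib, hγ]) z hz) hy hx
      refine h1.trans ?_
      calc B * ∑ k, |x k - y k| ≤ B * (d * min 1 (eucDist x y)) :=
            mul_le_mul_of_nonneg_left (sum_abs_sub_le hx hy) hB0
        _ = _ := by ring

end ApproximationError

section NumericalBounds

lemma HolderNormLeOn.mono {d ℓ : ℕ} {Ω : Set (Fin d → ℝ)} {g : (Fin d → ℝ) → ℝ} {E E' : ℝ}
    (h : HolderNormLeOn Ω ℓ g E) (hE : E ≤ E') : HolderNormLeOn Ω ℓ g E' := by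
  cases ℓ with
  | zero => exact fun x hx => (h x hx).trans hE
  | succ m =>
    exact ⟨fun γ hγ x hx => (h.1 γ hγ x hx).trans hE, fun γ hγ x hx y hy hxy =>
      (h.2 γ hγ x hx y hy hxy).trans (mul_le_mul_of_nonneg_right hE
        (le_min zero_le_one (Real.sqrt_nonneg _)))⟩

lemma le_two_pow_two_pow_of_loglog2_le {H : ℝ} {M : ℕ} (h : loglog2 H ≤ M) :
    H ≤ 2 ^ 2 ^ M := by
  by_cases hH : H ≤ 2
  · exact hH.trans (le_self_pow₀ one_le_two (by positivity))
  · rw [loglog2, if_neg hH] at h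
    push Not at hH
    have hlog : 0 < Real.logb 2 H := Real.logb_pos one_lt_two (by linarith)
    rw [Real.logb_le_iff_le_rpow one_lt_two hlog, Real.rpow_natCast,
      Real.logb_le_iff_le_rpow one_lt_two (by linarith)] at h
    exact_mod_cast h

lemma mul_six_pow_mul_pow_le {H : ℝ} {d n q M : ℕ} (hd : 0 < d) (hn : 1 ≤ n) (hq : 2 ≤ q)
    (hH : H ≤ 2 ^ 2 ^ M) :
    H * (6 ^ (q + 1) * (n : ℝ) ^ q) ^ d ≤ ((16 * (n : ℝ) ^ 2) ^ 2 ^ (q + 2 * M) / 4) ^ (q * d) := by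
  have hn' : (1 : ℝ) ≤ n := by exact_mod_cast hn
  set e := 2 ^ (q + 2 * M) with he
  have h4 : 2 ^ 2 ≤ e := Nat.pow_le_pow_right two_pos (by omega)
  have hM : 2 ^ M ≤ e := pow_le_pow_right₀ one_le_two (by omega)
  have h1 : (36 : ℝ) ≤ 4 ^ e / 4 := by
    have : (4 : ℝ) ^ 4 ≤ 4 ^ e := pow_le_pow_right₀ (by norm_num) h4
    linarith
  have h2 : (2 : ℝ) ^ 2 ^ M ≤ 4 ^ e :=
    (pow_le_pow_right₀ one_le_two hM).trans (pow_le_pow_left₀ two_pos.le (by norm_num) _)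
  have h3 : (n : ℝ) ≤ ((n : ℝ) ^ 2) ^ e := by
    rw [← pow_mul]; exact le_self_pow₀ hn' (by positivity)
  have hz : (2 : ℝ) ^ 2 ^ M * 36 * n ≤ (16 * (n : ℝ) ^ 2) ^ e / 4 := by
    calc (2 : ℝ) ^ 2 ^ M * 36 * n ≤ 4 ^ e * (4 ^ e / 4) * ((n : ℝ) ^ 2) ^ e := by gcongr
      _ = (16 * (n : ℝ) ^ 2) ^ e / 4 := by
        rw [mul_pow, show (16 : ℝ) = 4 * 4 by norm_num, mul_pow]; ring
  calc H * (6 ^ (q + 1) * (n : ℝ) ^ q) ^ d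
      ≤ 2 ^ 2 ^ M * (6 ^ (q + 1) * (n : ℝ) ^ q) ^ d := by gcongr
    _ ≤ (2 ^ 2 ^ M) ^ (q * d) * ((6 ^ 2) ^ q * (n : ℝ) ^ q) ^ d := by
        have h5 : (2 : ℝ) ^ 2 ^ M ≤ (2 ^ 2 ^ M) ^ (q * d) :=
          le_self_pow₀ (one_le_pow₀ one_le_two) (by positivity)
        have h6 : (6 : ℝ) ^ (q + 1) ≤ (6 ^ 2) ^ q := by
          rw [← pow_mul]; exact pow_le_pow_right₀ (by norm_num) (by omega)
        gcongr
    _ = (2 ^ 2 ^ M * 36 * n) ^ (q * d) := by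
        rw [← mul_pow (6 ^ 2 : ℝ), ← pow_mul _ q, ← mul_pow]; norm_num [mul_assoc]
    _ ≤ _ := by gcongr

lemma add_pow_le_exp_mul_pow {a : ℕ} (ha : 1 ≤ a) (ℓ : ℕ) :
    ((a + ℓ : ℕ) : ℝ) ^ a ≤ Real.exp 1 ^ ℓ * (a : ℝ) ^ a := by
  have ha' : (0 : ℝ) < a := by exact_mod_cast ha
  have h1 : ((a + ℓ : ℕ) : ℝ) ≤ Real.exp (ℓ / a) * a := by
    have := mul_le_mul_of_nonneg_right (Real.add_one_le_exp (ℓ / a : ℝ)) ha'.le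
    rw [add_mul, div_mul_cancel₀ _ ha'.ne'] at this
    push_cast; linarith
  calc ((a + ℓ : ℕ) : ℝ) ^ a ≤ (Real.exp (ℓ / a) * a) ^ a := by gcongr
    _ = Real.exp 1 ^ ℓ * (a : ℝ) ^ a := by
      rw [mul_pow, ← Real.exp_nat_mul, ← Real.exp_nat_mul, mul_div_cancel₀ _ ha'.ne', mul_one]

lemma spline_constant_le {d q a ℓ : ℕ} (hq : 2 ≤ q) (ha : 1 ≤ a)
    (hs : q + 1 = a + ℓ) :
    (d : ℝ) * 2 ^ ℓ * ((a + ℓ : ℕ) : ℝ) ^ a * q ^ ℓ * (3 * 6 ^ q) ^ d ≤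
      Real.exp 1 * (Real.sqrt 2 * Real.exp 1) ^ ℓ * (9 ^ d) ^ (a + ℓ) *
        ((2 * q + 1 : ℕ) : ℝ) ^ (2 * d + 2 * ℓ) * (a : ℝ) ^ a := by
  have hq' : (2 : ℝ) ≤ q := by exact_mod_cast hq
  have hd : (d : ℝ) ≤ 3 ^ d := by exact_mod_cast (Nat.lt_pow_self (by norm_num : 1 < 3)).le
  have h1 : (d : ℝ) * 3 ^ d ≤ ((2 * q + 1 : ℕ) : ℝ) ^ (2 * d) := by
    calc (d : ℝ) * 3 ^ d ≤ 3 ^ d * 3 ^ d := by gcongr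
      _ = 3 ^ (2 * d) := by rw [two_mul, pow_add]
      _ ≤ _ := by gcongr; push_cast; linarith
  have h2 : (2 : ℝ) ^ ℓ * q ^ ℓ ≤ ((2 * q + 1 : ℕ) : ℝ) ^ (2 * ℓ) := by
    calc (2 : ℝ) ^ ℓ * q ^ ℓ = (2 * q) ^ ℓ := (mul_pow _ _ _).symm
      _ ≤ ((2 * q + 1 : ℕ) : ℝ) ^ ℓ := by gcongr; push_cast; linarith
      _ ≤ _ := pow_le_pow_right₀ (by push_cast; linarith) (by omega)
  have h3 : (6 ^ q : ℝ) ^ d ≤ (9 ^ d) ^ (a + ℓ) := by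
    rw [← hs, ← pow_mul, ← pow_mul, mul_comm q d]
    exact (pow_le_pow_left₀ (by norm_num) (by norm_num) _).trans
      (pow_le_pow_right₀ (by norm_num) (Nat.mul_le_mul_left _ (by omega)))
  have h4 : (1 : ℝ) ≤ Real.exp 1 * Real.sqrt 2 ^ ℓ :=
    one_le_mul_of_one_le_of_one_le (Real.one_le_exp zero_le_one)
      (one_le_pow₀ (Real.one_le_sqrt.2 one_le_two))
  calc (d : ℝ) * 2 ^ ℓ * ((a + ℓ : ℕ) : ℝ) ^ a * q ^ ℓ * (3 * 6 ^ q) ^ d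
      = 1 * (d * 3 ^ d) * (2 ^ ℓ * q ^ ℓ) * (6 ^ q) ^ d * ((a + ℓ : ℕ) : ℝ) ^ a := by
        rw [mul_pow]; ring
    _ ≤ (Real.exp 1 * Real.sqrt 2 ^ ℓ) * ((2 * q + 1 : ℕ) : ℝ) ^ (2 * d) *
        ((2 * q + 1 : ℕ) : ℝ) ^ (2 * ℓ) * (9 ^ d) ^ (a + ℓ) * (Real.exp 1 ^ ℓ * (a : ℝ) ^ a) := by
        have := add_pow_le_exp_mul_pow ha ℓ
        gcongr
    _ = _ := by rw [mul_pow, pow_add _ (2 * d)]; ring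

lemma spline_error_le {d q a ℓ n K : ℕ} {Q R : ℝ} (hQ : 0 < Q) (hR : 0 < R) (hn : 1 ≤ n)
    (hK : 2 ≤ K) (hKn : K ≤ n * (q + 1)) (hq : 2 ≤ q) (ha : 1 ≤ a) (hs : q + 1 = a + ℓ) :
    (d : ℝ) * (Q * (R ^ (q + 1))⁻¹ * ((q + 1).factorial : ℝ) *
        ((2 * d) ^ (q + 1) / (q + 1).factorial) * (n : ℝ)⁻¹ ^ a * (q ^ ℓ * (3 * 6 ^ q) ^ d)) ≤
      Q * Real.exp 1 * (Real.sqrt 2 * Real.exp 1 * (d : ℝ) * (9 : ℝ) ^ d) ^ ℓ *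
        ((2 * q + 1 : ℕ) : ℝ) ^ (2 * d + 2 * ℓ) * (R ^ ℓ)⁻¹ *
        (2 * (d : ℝ) * (9 : ℝ) ^ d * (a : ℝ) / ((K : ℝ) * R)) ^ a := by
  have hK0 : (0 : ℝ) < K := by exact_mod_cast (by omega : 0 < K)
  have hn0 : (0 : ℝ) < n := by exact_mod_cast hn
  have hinv : (n : ℝ)⁻¹ ≤ ((a + ℓ : ℕ) : ℝ) * (K : ℝ)⁻¹ := by
    rw [← div_eq_mul_inv, le_div_iff₀ hK0, inv_mul_le_iff₀ hn0, ← hs]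
    exact_mod_cast hKn
  have hf : ((q + 1).factorial : ℝ) ≠ 0 := by positivity
  calc (d : ℝ) * (Q * (R ^ (q + 1))⁻¹ * ((q + 1).factorial : ℝ) *
        ((2 * d) ^ (q + 1) / (q + 1).factorial) * (n : ℝ)⁻¹ ^ a * (q ^ ℓ * (3 * 6 ^ q) ^ d))
      = d * (Q * (R ^ (q + 1))⁻¹ * (2 * d) ^ (q + 1) * (n : ℝ)⁻¹ ^ a *
        (q ^ ℓ * (3 * 6 ^ q) ^ d)) := by field_simp
    _ ≤ d * (Q * (R ^ (q + 1))⁻¹ * (2 * d) ^ (q + 1) * (((a + ℓ : ℕ) : ℝ) * (K : ℝ)⁻¹) ^ a *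
        (q ^ ℓ * (3 * 6 ^ q) ^ d)) := by gcongr
    _ = Q * (R ^ (a + ℓ))⁻¹ * d ^ (a + ℓ) * 2 ^ a * (K : ℝ)⁻¹ ^ a *
        (d * 2 ^ ℓ * ((a + ℓ : ℕ) : ℝ) ^ a * q ^ ℓ * (3 * 6 ^ q) ^ d) := by
        rw [hs, mul_pow, mul_pow, pow_add (2 : ℝ)]; ring
    _ ≤ Q * (R ^ (a + ℓ))⁻¹ * d ^ (a + ℓ) * 2 ^ a * (K : ℝ)⁻¹ ^ a *
        (Real.exp 1 * (Real.sqrt 2 * Real.exp 1) ^ ℓ * (9 ^ d) ^ (a + ℓ) *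
        ((2 * q + 1 : ℕ) : ℝ) ^ (2 * d + 2 * ℓ) * (a : ℝ) ^ a) :=
        mul_le_mul_of_nonneg_left (spline_constant_le hq ha hs) (by positivity)
    _ = _ := by
        rw [div_eq_mul_inv, mul_inv]
        simp only [mul_pow, pow_add, mul_inv, inv_pow]
        ring

lemma mul_le_pow_of_four_le {N d : ℕ} (hN : 4 ≤ N) (hd : 0 < d) : d * N ≤ N ^ d := by
  obtain ⟨e, rfl⟩ : ∃ e, d = e + 1 := ⟨d - 1, by omega⟩
  rw [pow_succ]
  exact Nat.mul_le_mul_right _ (Nat.lt_pow_self (by omega))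

lemma spline_net_width_le {d n V N K q : ℕ} (hd : 0 < d) (hn : 3 * n ≤ N) (hV : V ≤ N)
    (hN : N = K + q) (hK : 2 ≤ K) (hq : 2 ≤ q) :
    4 * (d + n) ≤ 4 * d * N ^ d ∧
      4 * (d * V + d + 1) ≤ max (4 * d * N ^ d) (12 * (K + 2 * q) + 12) ∧
      4 * d * V ^ d ≤ 4 * d * N ^ d := by
  have hle : N ≤ N ^ d := Nat.le_self_pow hd.ne' N
  refine ⟨?_, ?_, Nat.mul_le_mul_left _ (Nat.pow_le_pow_left hV d)⟩
  · nlinarith [Nat.mul_le_mul_left d hle]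
  · rcases Nat.lt_or_ge 1 d with h | h
    · refine le_max_of_le_left ?_
      have h1 : N ^ 2 ≤ N ^ d := Nat.pow_le_pow_right (by omega) h
      have h2 : 4 * N ≤ N ^ d := by nlinarith
      have h3 := Nat.mul_le_mul_left d h2
      have h4 := Nat.mul_le_mul_left d hV
      have h5 : d * 4 ≤ d * N := Nat.mul_le_mul_left d (by omega)
      nlinarith
    · obtain rfl : d = 1 := by omega
      refine le_max_of_le_right ?_
      omega

lemma spline_net_count_le {d n V N K m M p : ℕ} (hd : 0 < d) (hn : 3 * n ≤ N) (hV : V ≤ N)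
    (hN : N = K + (m + 2)) (hK : 2 ≤ K) (hM : 1 ≤ M) (hp : 0 < p) :
    8 * (d + n) + (d + 1) * (16 * n + 4) + (m + 2 + 2 * M) * ((d + 1) * 20) + (d + 1) * 36 +
        (d * V + d + 1) * (36 + 52 * m) + 72 * d * V ^ d + p * (V ^ d * 4) ≤
      p * N ^ d * (60 * M + 38 + 20 * d ^ 2 + 144 * d * (m + 2) + 8 * d) := by
  have hN4 : 4 ≤ N := by omega
  have h1 : d * N ≤ N ^ d := mul_le_pow_of_four_le hN4 hd
  have h2 : N ≤ N ^ d := Nat.le_self_pow hd.ne' N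
  have h3 : V ^ d ≤ N ^ d := Nat.pow_le_pow_left hV d
  have h4 : d * 4 ≤ d * N := Nat.mul_le_mul_left d hN4
  have h5 : d * V ≤ d * N := Nat.mul_le_mul_left d hV
  have h6 : d * (3 * n) ≤ d * N := Nat.mul_le_mul_left d hn
  set P := N ^ d
  have h7 : 2 * (d + 1) ≤ P := by omega
  have h8 : 2 * (d * V + d + 1) ≤ 3 * P := by omega
  have e1 : 8 * (d + n) + (d + 1) * (16 * n + 4) + (d + 1) * 36 ≤ 38 * P := by nlinarith
  have e2 : (m + 2 + 2 * M) * ((d + 1) * 20) ≤ (m + 2 + 2 * M) * (10 * P) :=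
    Nat.mul_le_mul_left _ (by omega)
  have e3 : (d * V + d + 1) * (36 + 52 * m) ≤ P * (54 + 78 * m) := by nlinarith
  have e4 : 72 * d * V ^ d ≤ 72 * d * P := Nat.mul_le_mul_left _ h3
  have e5 : p * (V ^ d * 4) ≤ p * (P * 4) := by gcongr
  have hX : 38 + (m + 2 + 2 * M) * 10 + (54 + 78 * m) + 72 * d + 4 * p ≤
      p * (60 * M + 38 + 20 * d ^ 2 + 144 * d * (m + 2) + 8 * d) := by
    obtain ⟨r, rfl⟩ : ∃ r, p = r + 1 := ⟨p - 1, by omega⟩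
    obtain ⟨c, rfl⟩ : ∃ c, d = c + 1 := ⟨d - 1, by omega⟩
    have : 0 ≤ c * m ∧ 0 ≤ r * M ∧ 0 ≤ r * (c * m) ∧ 0 ≤ r * c ∧ 0 ≤ r * m ∧ 0 ≤ c ^ 2 ∧
      0 ≤ r * c ^ 2 := by simp
    nlinarith
  calc _ ≤ P * (38 + (m + 2 + 2 * M) * 10 + (54 + 78 * m) + 72 * d + 4 * p) := by nlinarith
    _ ≤ P * (p * (60 * M + 38 + 20 * d ^ 2 + 144 * d * (m + 2) + 8 * d)) :=
        Nat.mul_le_mul_left _ hX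
    _ = _ := by ring

end NumericalBounds

theorem statement3 (d p : ℕ) (hd : 0 < d) (hp : 0 < p) (ℓ : ℕ) (Q R : ℝ)
    (hQ : 0 < Q) (hR : 0 < R) (f : (Fin d → ℝ) → Fin p → ℝ)
    (hf : QRanalytic p Q R f) (K : ℕ) (hK : 2 ≤ K)
    (s : ℕ) (hs : max (ℓ + 1) 3 ≤ s) :
    ∃ N : ReQUNet,
      N.arch 0 = d ∧ N.arch (N.L + 1) = p ∧
      N.width ≤ max (4 * d * (K + s - 1) ^ d) (max (12 * (K + 2 * s - 2) + 12) p) ∧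
      N.L = 6 + 2 * (s - 3) + Nat.clog 2 d +
        2 * max ⌈max (Real.logb 2 (((2 * d * (s - 1) + d : ℕ) : ℝ)))
            (loglog2 (Q * ((R : ℝ) ^ s)⁻¹ * (Nat.factorial s : ℝ)))⌉₊ 1 ∧
      N.weightsIn (Set.Icc (-1) 1) ∧
      N.numNonzero ≤ p * (K + s - 1) ^ d *
        (60 * max ⌈max (Real.logb 2 (((2 * d * (s - 1) + d : ℕ) : ℝ)))
            (loglog2 (Q * ((R : ℝ) ^ s)⁻¹ * (Nat.factorial s : ℝ)))⌉₊ 1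
          + 38 + 20 * d ^ 2 + 144 * d * (s - 1) + 8 * d) ∧
      VHolderNormLe p ℓ (fun x i => f x i - N.evalVec d x (i : ℕ))
        (Q * Real.exp 1 * (Real.sqrt 2 * Real.exp 1 * (d : ℝ) * (9 : ℝ) ^ d) ^ ℓ *
          ((2 * s - 1 : ℕ) : ℝ) ^ (2 * d + 2 * ℓ) * ((R : ℝ) ^ ℓ)⁻¹ *
          (2 * (d : ℝ) * (9 : ℝ) ^ d * ((s - ℓ : ℕ) : ℝ) / ((K : ℝ) * R)) ^ (s - ℓ)) := by
  obtain ⟨q, rfl⟩ : ∃ q, s = q + 1 := ⟨s - 1, by omega⟩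
  obtain ⟨m, rfl⟩ : ∃ m, q = m + 2 := ⟨q - 2, by omega⟩
  obtain ⟨hℓ, -⟩ := max_le_iff.1 hs
  simp only [show K + (m + 2 + 1) - 1 = K + (m + 2) by omega,
    show K + 2 * (m + 2 + 1) - 2 = K + 2 * (m + 2) by omega, show m + 2 + 1 - 3 = m by omega,
    show 2 * (m + 2 + 1) - 1 = 2 * (m + 2) + 1 by omega, Nat.add_sub_cancel]
  set H : ℝ := Q * (R ^ (m + 2 + 1))⁻¹ * ((m + 2 + 1).factorial : ℝ) with hH
  have hHnn : 0 ≤ H := by positivity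
  set M := max ⌈max (Real.logb 2 ((2 * d * (m + 2) + d : ℕ) : ℝ)) (loglog2 H)⌉₊ 1 with hM
  have hHM : H ≤ 2 ^ 2 ^ M := le_two_pow_two_pow_of_loglog2_le
    ((le_max_right _ _).trans ((Nat.le_ceil _).trans (by exact_mod_cast le_max_left _ _)))
  set n := (K - 1) / (m + 2 + 1) + 1 with hn
  have hn1 : 1 ≤ n := Nat.le_add_left 1 _
  have hdiv := Nat.div_add_mod (K - 1) (m + 2 + 1)
  have hmod := Nat.mod_lt (K - 1) (by omega : m + 2 + 1 > 0)
  have hnmul : n * (m + 2 + 1) = (m + 2 + 1) * ((K - 1) / (m + 2 + 1)) + (m + 2 + 1) := by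
    rw [hn]; ring
  have hKn : K ≤ n * (m + 2 + 1) := by omega
  have hnK : n * (m + 2 + 1) ≤ K + (m + 2) := by omega
  have hn3 : 3 * n ≤ K + (m + 2) := by nlinarith
  have hcard : Fintype.card (Fin n × Fin (m + 2 + 1)) = n * (m + 2 + 1) := by simp
  have hnode : ∀ P : Fin n × Fin (m + 2 + 1), |blockNode (m + 2) n P.1 P.2| ≤ 1 := by
    intro P
    have hn0 : (1 : ℝ) ≤ n := by exact_mod_cast hn1
    have hP : ((P.1 : ℕ) : ℝ) ≤ n := by exact_mod_cast P.1.2.le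
    refine abs_le.2 ⟨le_trans ?_ (le_blockNode P.2), (blockNode_lt hn1 P.2).le.trans ?_⟩
    · rw [le_div_iff₀ (by linarith)]
      have : (0 : ℝ) ≤ (P.1 : ℕ) := Nat.cast_nonneg _
      linarith
    · exact div_le_one_of_le₀ hP (by linarith)
  obtain ⟨hw1, hw2, hw3⟩ := spline_net_width_le hd hn3 hnK rfl hK (by omega : 2 ≤ m + 2)
  have hcoeff : ∀ (i : Fin p) J, |interpCoeff (m + 2) n (fun κ => mderiv κ fun x => f x i) J| ≤
      ((16 * (n : ℝ) ^ 2) ^ 2 ^ (m + 2 + 2 * M) / 4) ^ ((m + 2) * d) := fun i J =>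
    (abs_interpCoeff_le hn1 hHnn (fun α hα => (hf.2 (m + 2 + 1) i).1 α hα) J).trans
      (mul_six_pow_mul_pow_le hd hn1 (by omega) hHM)
  obtain ⟨N, hN0, hN1, hwidth, hL, hweights, hcount, heval⟩ := exists_reQUNet_tensor
    (w := max (4 * d * (K + (m + 2)) ^ d) (max (12 * (K + 2 * (m + 2)) + 12) p)) hd hn1 hnode
    (fun i => interpCoeff (m + 2) n (fun κ => mderiv κ fun x => f x i)) rfl hcoeff
    (le_max_of_le_left hw1)
    (by rw [hcard, ← max_assoc]; exact le_max_of_le_left hw2)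
    (by rw [hcard]; exact le_max_of_le_left hw3)
    (le_max_of_le_right (le_max_right _ _))
  refine ⟨N, hN0, hN1, hwidth, by omega, hweights, ?_, fun i => ?_⟩
  · rw [hcard] at hcount
    exact hcount.trans (spline_net_count_le hd hn3 hnK rfl hK (le_max_right _ _) hp)
  · have hspline := holderNormLeOn_sub_interpSpline hd hn1 (by omega : ℓ ≤ m + 2) (by omega)
      (hf.1 i) (hf.2 (m + 2 + 1) i)
    simp only [heval]
    exact hspline.mono (spline_error_le hQ hR hn1 hK hKn (by omega) (by omega) (by omega))
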